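/- arXiv:1503.03786 — 17 statements merged into one kernel-verified Lean document; each statement's English description precedes it below -/
import Mathlib

section
/- Let X be a discrete random variable taking values x_1,…,x_n in the interval [m,M] with probabilities p_1,…,p_n. Then the fourth central moment satisfies μ₄ ≤ (M−m)⁴/12. -/
/-- On `[-b, a]`, the function `y ↦ y ^ 4` lies below the chord joining its endpoints. -/
lemma pow_four_le_chord {a b y : ℝ} (hya : y ≤ a) (hby : -b ≤ y) :
    y ^ 4 ≤ a * b * (a ^ 2 - a * b + b ^ 2) + (a - b) * (a ^ 2 + b ^ 2) * y := by
  have hq : 0 ≤ y ^ 2 + (a - b) * y + (a ^ 2 - a * b + b ^ 2) := by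
    nlinarith [sq_nonneg (2 * y + (a - b)), sq_nonneg (a - b), sq_nonneg a, sq_nonneg b]
  have h := mul_nonneg (mul_nonneg (sub_nonneg.2 hya) (neg_le_iff_add_nonneg.1 hby)) hq
  linear_combination h

/-- **Theorem 2.1** (Popoviciu-type bound for the fourth central moment):
If a discrete random variable takes values `x 1, …, x n` in `[m, M]` with
probabilities `p 1, …, p n`, then `μ₄ ≤ (M − m)⁴ / 12`. -/
theorem fourth_central_moment_le {n : ℕ} (p x : Fin n → ℝ) (m M : ℝ)
    (hp : ∀ i, 0 ≤ p i) (hp1 : ∑ i, p i = 1)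
    (hx : ∀ i, x i ∈ Set.Icc m M)
    (μ : ℝ) (hμ : μ = ∑ i, p i * x i)
    (μ₄ : ℝ) (hμ₄ : μ₄ = ∑ i, p i * (x i - μ) ^ 4) :
    μ₄ ≤ (M - m) ^ 4 / 12 := by
  have hsum : ∑ i, p i * (x i - μ) = 0 := by
    simp only [mul_sub, Finset.sum_sub_distrib, ← Finset.sum_mul, hp1, ← hμ]
    ring
  have hle : μ₄ ≤ (M - μ) * (μ - m) * ((M - μ) ^ 2 - (M - μ) * (μ - m) + (μ - m) ^ 2) := by
    rw [hμ₄]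
    set d := (M - μ) * (μ - m) * ((M - μ) ^ 2 - (M - μ) * (μ - m) + (μ - m) ^ 2)
    set c := ((M - μ) - (μ - m)) * ((M - μ) ^ 2 + (μ - m) ^ 2)
    calc ∑ i, p i * (x i - μ) ^ 4 ≤ ∑ i, p i * (d + c * (x i - μ)) := by
          refine Finset.sum_le_sum fun i _ => mul_le_mul_of_nonneg_left ?_ (hp i)
          exact pow_four_le_chord (by linarith [(hx i).2]) (by linarith [(hx i).1])
      _ = (∑ i, p i) * d + c * ∑ i, p i * (x i - μ) := by
          rw [Finset.sum_mul, Finset.mul_sum, ← Finset.sum_add_distrib]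
          exact Finset.sum_congr rfl fun i _ => by ring
      _ = d := by rw [hp1, hsum]; ring
  linear_combination hle + (1 / 12) * sq_nonneg ((M - m) ^ 2 - 6 * ((M - μ) * (μ - m)))
end

section
/- Let X be a discrete random variable taking values x_1,…,x_n in the interval [m,M] with probabilities p_1,…,p_n, and suppose μ₂ ≠ (μ₁'−m)(M−μ₁'). Then μ₄ ≤ (μ₁'−m)(M−μ₁')μ₂ + (m+M−2μ₁')μ₃ − (μ₃ − (m+M−2μ₁')μ₂)² / ((μ₁'−m)(M−μ₁') − μ₂). -/
/-- **Theorem 2.2**: upper bound for the fourth central moment in terms of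
the second and third central moments, when `μ₂ ≠ (μ₁'−m)(M−μ₁')`. -/
theorem fourth_central_moment_upper_bound {n : ℕ} (p x : Fin n → ℝ) (m M : ℝ)
    (hp : ∀ i, 0 ≤ p i) (hp1 : ∑ i, p i = 1)
    (hx : ∀ i, x i ∈ Set.Icc m M)
    (μ : ℝ) (hμ : μ = ∑ i, p i * x i)
    (μ₂ : ℝ) (hμ₂ : μ₂ = ∑ i, p i * (x i - μ) ^ 2)
    (μ₃ : ℝ) (hμ₃ : μ₃ = ∑ i, p i * (x i - μ) ^ 3)
    (μ₄ : ℝ) (hμ₄ : μ₄ = ∑ i, p i * (x i - μ) ^ 4)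
    (hne : μ₂ ≠ (μ - m) * (M - μ)) :
    μ₄ ≤ (μ - m) * (M - μ) * μ₂ + (m + M - 2 * μ) * μ₃ -
      (μ₃ - (m + M - 2 * μ) * μ₂) ^ 2 / ((μ - m) * (M - μ) - μ₂) := by
  have hmean : ∑ i, p i * (x i - μ) = 0 := by
    simp only [mul_sub, Finset.sum_sub_distrib, ← Finset.sum_mul, hp1, ← hμ]
    ring
  -- The weights `w i` are nonnegative; Cauchy–Schwarz is applied to their first three moments.
  set w : Fin n → ℝ := fun i => p i * ((x i - m) * (M - x i)) with hw
  have hw_nonneg (i) : 0 ≤ w i :=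
    mul_nonneg (hp i) (mul_nonneg (sub_nonneg.2 (hx i).1) (sub_nonneg.2 (hx i).2))
  have hw_zero : ∑ i, w i = (μ - m) * (M - μ) - μ₂ := by
    calc ∑ i, w i = ∑ i, ((μ - m) * (M - μ) * p i
          + (m + M - 2 * μ) * (p i * (x i - μ)) - p i * (x i - μ) ^ 2) :=
          Finset.sum_congr rfl fun i _ => by simp only [hw]; ring
      _ = _ := by
        rw [Finset.sum_sub_distrib, Finset.sum_add_distrib, ← Finset.mul_sum, ← Finset.mul_sum,
          hp1, hmean, ← hμ₂]
        ring
  have hw_one : ∑ i, w i * (x i - μ) = (m + M - 2 * μ) * μ₂ - μ₃ := by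
    calc ∑ i, w i * (x i - μ) = ∑ i, ((μ - m) * (M - μ) * (p i * (x i - μ))
          + (m + M - 2 * μ) * (p i * (x i - μ) ^ 2) - p i * (x i - μ) ^ 3) :=
          Finset.sum_congr rfl fun i _ => by simp only [hw]; ring
      _ = _ := by
        rw [Finset.sum_sub_distrib, Finset.sum_add_distrib, ← Finset.mul_sum, ← Finset.mul_sum,
          hmean, ← hμ₂, ← hμ₃]
        ring
  have hw_two : ∑ i, w i * (x i - μ) ^ 2
      = (μ - m) * (M - μ) * μ₂ + (m + M - 2 * μ) * μ₃ - μ₄ := by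
    calc ∑ i, w i * (x i - μ) ^ 2 = ∑ i, ((μ - m) * (M - μ) * (p i * (x i - μ) ^ 2)
          + (m + M - 2 * μ) * (p i * (x i - μ) ^ 3) - p i * (x i - μ) ^ 4) :=
          Finset.sum_congr rfl fun i _ => by simp only [hw]; ring
      _ = _ := by
        rw [Finset.sum_sub_distrib, Finset.sum_add_distrib, ← Finset.mul_sum, ← Finset.mul_sum,
          ← hμ₂, ← hμ₃, ← hμ₄]
  have hpos : 0 < (μ - m) * (M - μ) - μ₂ :=
    lt_of_le_of_ne (hw_zero ▸ Finset.sum_nonneg fun i _ => hw_nonneg i) (sub_ne_zero.2 hne.symm).symm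
  have hcs : (∑ i, w i * (x i - μ)) ^ 2 ≤ (∑ i, w i) * ∑ i, w i * (x i - μ) ^ 2 :=
    Finset.sum_sq_le_sum_mul_sum_of_sq_le_mul _ (fun i _ => hw_nonneg i)
      (fun i _ => mul_nonneg (hw_nonneg i) (sq_nonneg _)) (fun i _ => le_of_eq (by ring))
  rw [hw_zero, hw_one, hw_two] at hcs
  rw [le_sub_comm, div_le_iff₀ hpos]
  linarith
end

section
/- Let X be a discrete random variable taking values x_1,…,x_n in the interval [m,M] with probabilities p_1,…,p_n. Then for every real number γ, μ₄ ≤ ((μ₁'−m)(M−μ₁') − μ₂)γ² − 2((m+M−2μ₁')μ₂ − μ₃)γ + (m+M−2μ₁')μ₃ + (μ₁'−m)(M−μ₁')μ₂. -/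
/-- Inequality (2.7): for every real `γ`,
`μ₄ ≤ ((μ₁'−m)(M−μ₁') − μ₂)γ² − 2((m+M−2μ₁')μ₂ − μ₃)γ + (m+M−2μ₁')μ₃ + (μ₁'−m)(M−μ₁')μ₂`. -/
theorem fourth_central_moment_le_quadratic {n : ℕ} (p x : Fin n → ℝ) (m M : ℝ)
    (hp : ∀ i, 0 ≤ p i) (hp1 : ∑ i, p i = 1)
    (hx : ∀ i, x i ∈ Set.Icc m M)
    (μ : ℝ) (hμ : μ = ∑ i, p i * x i)
    (μ₂ : ℝ) (hμ₂ : μ₂ = ∑ i, p i * (x i - μ) ^ 2)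
    (μ₃ : ℝ) (hμ₃ : μ₃ = ∑ i, p i * (x i - μ) ^ 3)
    (μ₄ : ℝ) (hμ₄ : μ₄ = ∑ i, p i * (x i - μ) ^ 4)
    (γ : ℝ) :
    μ₄ ≤ ((μ - m) * (M - μ) - μ₂) * γ ^ 2 -
      2 * ((m + M - 2 * μ) * μ₂ - μ₃) * γ +
      (m + M - 2 * μ) * μ₃ + (μ - m) * (M - μ) * μ₂ := by
  have h_mean : ∑ i, p i * (x i - μ) = 0 := by
    simp only [mul_sub, Finset.sum_sub_distrib, ← Finset.sum_mul, hp1, ← hμ, one_mul, sub_self]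
  have h_nonneg : 0 ≤ ∑ i, p i * ((x i - m) * (M - x i) * (x i - μ - γ) ^ 2) :=
    Finset.sum_nonneg fun i _ => mul_nonneg (hp i) <| mul_nonneg
      (mul_nonneg (sub_nonneg.2 (hx i).1) (sub_nonneg.2 (hx i).2)) (sq_nonneg _)
  have h_expand : ∑ i, p i * ((x i - m) * (M - x i) * (x i - μ - γ) ^ 2) =
      (μ - m) * (M - μ) * γ ^ 2 * ∑ i, p i +
      ((m + M - 2 * μ) * γ ^ 2 - 2 * (μ - m) * (M - μ) * γ) * ∑ i, p i * (x i - μ) +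
      ((μ - m) * (M - μ) - 2 * (m + M - 2 * μ) * γ - γ ^ 2) * ∑ i, p i * (x i - μ) ^ 2 +
      (m + M - 2 * μ + 2 * γ) * ∑ i, p i * (x i - μ) ^ 3 -
      ∑ i, p i * (x i - μ) ^ 4 := by
    simp only [Finset.mul_sum, ← Finset.sum_add_distrib, ← Finset.sum_sub_distrib]
    exact Finset.sum_congr rfl fun i _ => by ring
  rw [h_expand, hp1, h_mean, ← hμ₂, ← hμ₃, ← hμ₄] at h_nonneg
  linarith
end

section
/- Let X be a discrete random variable taking values x_1,…,x_n in the interval [m,M] with probabilities p_1,…,p_n, and suppose μ₂ ≠ (μ₁'−m)(M−μ₁'). Then μ₂μ₄ − μ₂³ − μ₃² ≤ ((μ₁'−m)(M−μ₁')(M−m))²/27 ≤ (M−m)⁶/432. -/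
/-- The Cauchy–Schwarz inequality for finite sums with nonnegative weights. -/
theorem sq_sum_weighted_mul_le {ι : Type*} (s : Finset ι) (w y : ι → ℝ)
    (hw : ∀ i ∈ s, 0 ≤ w i) :
    (∑ i ∈ s, w i * y i) ^ 2 ≤ (∑ i ∈ s, w i) * ∑ i ∈ s, w i * y i ^ 2 :=
  Finset.sum_sq_le_sum_mul_sum_of_sq_le_mul s hw
    (fun i hi => mul_nonneg (hw i hi) (sq_nonneg _)) (fun i _ => le_of_eq (by ring))

/-- The bound on the moment determinant `s * q - s ^ 3 - t ^ 2` that follows from the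
Cauchy–Schwarz constraint on the moments of a centered variable with values in `[-a, b]`. -/
theorem moment_det_le_of_constraint {a b s t q : ℝ} (hs : 0 ≤ s) (hsab : s < a * b)
    (h : ((b - a) * s - t) ^ 2 ≤ (a * b - s) * (a * b * s + (b - a) * t - q)) :
    s * q - s ^ 3 - t ^ 2 ≤ (a * b * (a + b)) ^ 2 / 27 := by
  have hP : 0 < a * b := hs.trans_lt hsab
  have he : 0 < a * b - s := sub_pos.mpr hsab
  have h_det : 4 * (a * b) * (s * q - s ^ 3 - t ^ 2) ≤ s ^ 2 * (a * b - s) * (a + b) ^ 2 := by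
    refine le_of_mul_le_mul_left ?_ he
    linear_combination 4 * (a * b) * s * h +
      sq_nonneg (2 * (a * b) * t - s * (b - a) * (a * b + s))
  have h_cubic : s ^ 2 * (a * b - s) ≤ 4 * (a * b) ^ 3 / 27 := by
    have : 0 ≤ (s - 2 * (a * b) / 3) ^ 2 * (s + a * b / 3) := by positivity
    linear_combination this
  refine le_of_mul_le_mul_left ?_ (show 0 < 4 * (a * b) by positivity)
  linear_combination h_det + (a + b) ^ 2 * h_cubic


/-- **Corollary 2.3** (inequality (2.9)):
`μ₂μ₄ − μ₂³ − μ₃² ≤ ((μ₁'−m)(M−μ₁')(M−m))²/27 ≤ (M−m)⁶/432`. -/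
theorem moment_det_upper_bound {n : ℕ} (p x : Fin n → ℝ) (m M : ℝ)
    (hp : ∀ i, 0 ≤ p i) (hp1 : ∑ i, p i = 1)
    (hx : ∀ i, x i ∈ Set.Icc m M)
    (μ : ℝ) (hμ : μ = ∑ i, p i * x i)
    (μ₂ : ℝ) (hμ₂ : μ₂ = ∑ i, p i * (x i - μ) ^ 2)
    (μ₃ : ℝ) (hμ₃ : μ₃ = ∑ i, p i * (x i - μ) ^ 3)
    (μ₄ : ℝ) (hμ₄ : μ₄ = ∑ i, p i * (x i - μ) ^ 4)
    (hne : μ₂ ≠ (μ - m) * (M - μ)) :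
    μ₂ * μ₄ - μ₂ ^ 3 - μ₃ ^ 2 ≤ ((μ - m) * (M - μ) * (M - m)) ^ 2 / 27 ∧
      ((μ - m) * (M - μ) * (M - m)) ^ 2 / 27 ≤ (M - m) ^ 6 / 432 := by
  have hma : ∑ i, p i * (x i - μ) = 0 := by
    simp only [mul_sub, Finset.sum_sub_distrib, ← Finset.sum_mul, hp1, ← hμ]
    ring
  have hw : ∀ i ∈ Finset.univ, 0 ≤ p i * ((x i - m) * (M - x i)) := fun i _ =>
    mul_nonneg (hp i) (mul_nonneg (sub_nonneg.mpr (hx i).1) (sub_nonneg.mpr (hx i).2))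
  have hw₀ : ∑ i, p i * ((x i - m) * (M - x i)) = (μ - m) * (M - μ) - μ₂ := by
    calc _ = ∑ i, ((μ - m) * (M - μ) * p i + ((M - μ) - (μ - m)) * (p i * (x i - μ))
            - p i * (x i - μ) ^ 2) := Finset.sum_congr rfl fun i _ => by ring
      _ = _ := by
        rw [Finset.sum_sub_distrib, Finset.sum_add_distrib, ← Finset.mul_sum, ← Finset.mul_sum,
          hp1, hma, ← hμ₂]
        ring
  have hw₁ : ∑ i, p i * ((x i - m) * (M - x i)) * (x i - μ) =
      ((M - μ) - (μ - m)) * μ₂ - μ₃ := by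
    calc _ = ∑ i, ((μ - m) * (M - μ) * (p i * (x i - μ))
            + ((M - μ) - (μ - m)) * (p i * (x i - μ) ^ 2)
            - p i * (x i - μ) ^ 3) := Finset.sum_congr rfl fun i _ => by ring
      _ = _ := by
        rw [Finset.sum_sub_distrib, Finset.sum_add_distrib, ← Finset.mul_sum, ← Finset.mul_sum,
          hma, ← hμ₂, ← hμ₃]
        ring
  have hw₂ : ∑ i, p i * ((x i - m) * (M - x i)) * (x i - μ) ^ 2 =
      (μ - m) * (M - μ) * μ₂ + ((M - μ) - (μ - m)) * μ₃ - μ₄ := by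
    calc _ = ∑ i, ((μ - m) * (M - μ) * (p i * (x i - μ) ^ 2)
            + ((M - μ) - (μ - m)) * (p i * (x i - μ) ^ 3)
            - p i * (x i - μ) ^ 4) := Finset.sum_congr rfl fun i _ => by ring
      _ = _ := by
        rw [Finset.sum_sub_distrib, Finset.sum_add_distrib, ← Finset.mul_sum, ← Finset.mul_sum,
          ← hμ₂, ← hμ₃, ← hμ₄]
  have hμ₂_nonneg : 0 ≤ μ₂ :=
    hμ₂ ▸ Finset.sum_nonneg fun i _ => mul_nonneg (hp i) (sq_nonneg _)
  have hμ₂_le : μ₂ ≤ (μ - m) * (M - μ) := sub_nonneg.mp (hw₀ ▸ Finset.sum_nonneg hw)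
  have h_cs := sq_sum_weighted_mul_le Finset.univ _ (fun i => x i - μ) hw
  rw [hw₀, hw₁, hw₂] at h_cs
  constructor
  · have h := moment_det_le_of_constraint hμ₂_nonneg (lt_of_le_of_ne hμ₂_le hne) h_cs
    rwa [show μ - m + (M - μ) = M - m by ring] at h
  · have h_amgm : (μ - m) * (M - μ) ≤ (M - m) ^ 2 / 4 := by
      linear_combination sq_nonneg ((μ - m) - (M - μ)) / 4
    have h_sq := pow_le_pow_left₀ (hμ₂_nonneg.trans hμ₂_le) h_amgm 2
    linear_combination (M - m) ^ 2 / 27 * h_sq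
end

section
/- Let X be a discrete random variable taking values x_1,…,x_n in the interval [m,M] with probabilities p_1,…,p_n, and suppose 0 < μ₂ < (μ₁'−m)(M−μ₁'). Then μ₂μ₄ − μ₂³ − μ₃² ≤ (1 − μ₂/((μ₁'−m)(M−μ₁')))·((M−m)/2)²·μ₂². -/
/-- Inequality (2.11): if `0 < μ₂ < (μ₁'−m)(M−μ₁')`, then
`μ₂μ₄ − μ₂³ − μ₃² ≤ (1 − μ₂/((μ₁'−m)(M−μ₁')))((M−m)/2)²μ₂²`. -/
theorem moment_det_le {n : ℕ} (p x : Fin n → ℝ) (m M : ℝ)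
    (hp : ∀ i, 0 ≤ p i) (hp1 : ∑ i, p i = 1)
    (hx : ∀ i, x i ∈ Set.Icc m M)
    (μ : ℝ) (hμ : μ = ∑ i, p i * x i)
    (μ₂ : ℝ) (hμ₂ : μ₂ = ∑ i, p i * (x i - μ) ^ 2)
    (μ₃ : ℝ) (hμ₃ : μ₃ = ∑ i, p i * (x i - μ) ^ 3)
    (μ₄ : ℝ) (hμ₄ : μ₄ = ∑ i, p i * (x i - μ) ^ 4)
    (hpos : 0 < μ₂) (hlt : μ₂ < (μ - m) * (M - μ)) :
    μ₂ * μ₄ - μ₂ ^ 3 - μ₃ ^ 2 ≤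
      (1 - μ₂ / ((μ - m) * (M - μ))) * ((M - m) / 2) ^ 2 * μ₂ ^ 2 := by
  have hP : 0 < (μ - m) * (M - μ) := hpos.trans hlt
  obtain ⟨c, hc⟩ : ∃ c, c = (M + m - 2 * μ) * μ₂ / (2 * ((μ - m) * (M - μ))) := ⟨_, rfl⟩
  have mean_zero : ∑ i, p i * (x i - μ) = 0 := by
    simp only [mul_sub, Finset.sum_sub_distrib, ← Finset.sum_mul, hp1, ← hμ]
    ring
  have quartic_nonneg :
      0 ≤ ∑ i, p i * ((x i - m) * (M - x i) * (x i - μ - c) ^ 2) :=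
    Finset.sum_nonneg fun i _ => mul_nonneg (hp i) <|
      mul_nonneg (mul_nonneg (sub_nonneg.2 (hx i).1) (sub_nonneg.2 (hx i).2)) (sq_nonneg _)
  have quartic_eq : ∑ i, p i * ((x i - m) * (M - x i) * (x i - μ - c) ^ 2) =
      -μ₄ + (M + m - 2 * μ + 2 * c) * μ₃
        + ((μ - m) * (M - μ) - 2 * c * (M + m - 2 * μ) - c ^ 2) * μ₂
        + (μ - m) * (M - μ) * c ^ 2 := by
    calc
      _ = ∑ i, (-(p i * (x i - μ) ^ 4)
            + (M + m - 2 * μ + 2 * c) * (p i * (x i - μ) ^ 3)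
            + ((μ - m) * (M - μ) - 2 * c * (M + m - 2 * μ) - c ^ 2) * (p i * (x i - μ) ^ 2)
            + (c ^ 2 * (M + m - 2 * μ) - 2 * c * ((μ - m) * (M - μ))) * (p i * (x i - μ))
            + (μ - m) * (M - μ) * c ^ 2 * p i) :=
        Finset.sum_congr rfl fun i _ => by ring
      _ = _ := by
        simp only [Finset.sum_add_distrib, Finset.sum_neg_distrib, ← Finset.mul_sum, mean_zero,
          hp1, ← hμ₂, ← hμ₃, ← hμ₄]
        ring
  rw [quartic_eq] at quartic_nonneg
  have gap_eq : (1 - μ₂ / ((μ - m) * (M - μ))) * ((M - m) / 2) ^ 2 * μ₂ ^ 2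
        - (μ₂ * μ₄ - μ₂ ^ 3 - μ₃ ^ 2) =
      μ₂ * (-μ₄ + (M + m - 2 * μ + 2 * c) * μ₃
        + ((μ - m) * (M - μ) - 2 * c * (M + m - 2 * μ) - c ^ 2) * μ₂
        + (μ - m) * (M - μ) * c ^ 2)
      + (μ₃ - μ₂ * (M + m - 2 * μ + 2 * c) / 2) ^ 2 := by
    have ha : μ - m ≠ 0 := left_ne_zero_of_mul hP.ne'
    have hb : M - μ ≠ 0 := right_ne_zero_of_mul hP.ne'
    rw [hc]
    field_simp
    ring
  have := mul_nonneg hpos.le quartic_nonneg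
  linarith [sq_nonneg (μ₃ - μ₂ * (M + m - 2 * μ + 2 * c) / 2)]
end

section
/- Let X be a discrete random variable taking values x_1,…,x_n in the interval [m,M] with probabilities p_1,…,p_n, and suppose 0 < μ₂ < (μ₁'−m)(M−μ₁'). Then μ₄ − μ₂² − μ₃²/μ₂ ≤ (μ₁'−m)(M−μ₁')·((M−m)/4)² ≤ (M−m)⁴/64. -/
/-- **Corollary 2.4** (inequality (2.13)): if `0 < μ₂ < (μ₁'−m)(M−μ₁')`, then
`μ₄ − μ₂² − μ₃²/μ₂ ≤ (μ₁'−m)(M−μ₁')((M−m)/4)² ≤ (M−m)⁴/64`. -/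
theorem pearson_complement {n : ℕ} (p x : Fin n → ℝ) (m M : ℝ)
    (hp : ∀ i, 0 ≤ p i) (hp1 : ∑ i, p i = 1)
    (hx : ∀ i, x i ∈ Set.Icc m M)
    (μ : ℝ) (hμ : μ = ∑ i, p i * x i)
    (μ₂ : ℝ) (hμ₂ : μ₂ = ∑ i, p i * (x i - μ) ^ 2)
    (μ₃ : ℝ) (hμ₃ : μ₃ = ∑ i, p i * (x i - μ) ^ 3)
    (μ₄ : ℝ) (hμ₄ : μ₄ = ∑ i, p i * (x i - μ) ^ 4)
    (hpos : 0 < μ₂) (hlt : μ₂ < (μ - m) * (M - μ)) :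
    μ₄ - μ₂ ^ 2 - μ₃ ^ 2 / μ₂ ≤ (μ - m) * (M - μ) * ((M - m) / 4) ^ 2 ∧
      (μ - m) * (M - μ) * ((M - m) / 4) ^ 2 ≤ (M - m) ^ 4 / 64 := by
  have hmean : ∑ i, p i * (x i - μ) = 0 := by
    simp only [mul_sub, Finset.sum_sub_distrib, ← Finset.sum_mul, hp1, ← hμ]
    ring
  obtain ⟨a, ha⟩ : ∃ a, a = μ - m := ⟨_, rfl⟩
  obtain ⟨b, hb⟩ : ∃ b, b = M - μ := ⟨_, rfl⟩
  have hab : M - m = a + b := by rw [ha, hb]; ring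
  rw [← ha, ← hb] at hlt
  rw [← ha, ← hb, hab]
  have hP : 0 < a * b := hpos.trans hlt
  refine ⟨?_, by nlinarith [mul_nonneg (sq_nonneg (a + b)) (sq_nonneg (a - b))]⟩
  have hquartic (c : ℝ) :
      μ₄ ≤ a * b * μ₂ + (b - a) * μ₃ + 2 * c * (μ₃ - (b - a) * μ₂) + c ^ 2 * (a * b - μ₂) := by
    have hnonneg : 0 ≤ ∑ i, p i * ((x i - μ + a) * (b - (x i - μ)) * (x i - μ - c) ^ 2) := by
      refine Finset.sum_nonneg fun i _ => mul_nonneg (hp i) (mul_nonneg (mul_nonneg ?_ ?_)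
        (sq_nonneg _))
      · linarith [(hx i).1]
      · linarith [(hx i).2]
    have hexpand : ∑ i, p i * ((x i - μ + a) * (b - (x i - μ)) * (x i - μ - c) ^ 2) =
        a * b * c ^ 2 * ∑ i, p i + ((b - a) * c ^ 2 - 2 * c * (a * b)) * ∑ i, p i * (x i - μ)
        + (a * b - 2 * c * (b - a) - c ^ 2) * ∑ i, p i * (x i - μ) ^ 2
        + (b - a + 2 * c) * ∑ i, p i * (x i - μ) ^ 3 - ∑ i, p i * (x i - μ) ^ 4 := by
      simp only [Finset.mul_sum, ← Finset.sum_add_distrib, ← Finset.sum_sub_distrib]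
      exact Finset.sum_congr rfl fun i _ => by ring
    rw [hexpand, hp1, hmean, ← hμ₂, ← hμ₃, ← hμ₄] at hnonneg
    linarith
  -- The choice of `c` that is optimal at the extremal value of `μ₃`.
  obtain ⟨c, hc⟩ : ∃ c, c = μ₂ * (b - a) / (2 * (a * b)) := ⟨_, rfl⟩
  have hskew : (b - a + 2 * c) * μ₃ - μ₃ ^ 2 / μ₂ ≤ μ₂ * (b - a + 2 * c) ^ 2 / 4 := by
    have hsq : μ₂ * (b - a + 2 * c) ^ 2 / 4 - ((b - a + 2 * c) * μ₃ - μ₃ ^ 2 / μ₂) =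
        (μ₂ * (b - a + 2 * c) / 2 - μ₃) ^ 2 / μ₂ := by
      field_simp
      ring
    linarith [div_nonneg (sq_nonneg (μ₂ * (b - a + 2 * c) / 2 - μ₃)) hpos.le]
  have hsum : μ₂ * (a * b - μ₂) + a * b * c ^ 2 - c * (b - a) * μ₂ + μ₂ * (b - a) ^ 2 / 4 =
      a * b * ((a + b) / 4) ^ 2 - (a * b - 2 * μ₂) ^ 2 * (a + b) ^ 2 / (16 * (a * b)) := by
    have ha0 : a ≠ 0 := left_ne_zero_of_mul hP.ne'
    have hb0 : b ≠ 0 := right_ne_zero_of_mul hP.ne'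
    rw [hc]
    field_simp
    ring
  have hrem : 0 ≤ (a * b - 2 * μ₂) ^ 2 * (a + b) ^ 2 / (16 * (a * b)) := by positivity
  linarith [hquartic c]
end

section
/- Let X be a discrete random variable taking values x_1,…,x_n in the interval [m,M] with probabilities p_1,…,p_n, and suppose μ₂ > 0. Then μ₄/μ₂² − μ₃²/μ₂³ ≤ (M−m)²/(4μ₂). -/
/-- Inequality (2.18): if `μ₂ > 0`, then
`μ₄/μ₂² − μ₃²/μ₂³ ≤ (M−m)²/(4μ₂)`. -/
theorem kurtosis_sub_skewness_sq_le {n : ℕ} (p x : Fin n → ℝ) (m M : ℝ)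
    (hp : ∀ i, 0 ≤ p i) (hp1 : ∑ i, p i = 1)
    (hx : ∀ i, x i ∈ Set.Icc m M)
    (μ : ℝ) (hμ : μ = ∑ i, p i * x i)
    (μ₂ : ℝ) (hμ₂ : μ₂ = ∑ i, p i * (x i - μ) ^ 2)
    (μ₃ : ℝ) (hμ₃ : μ₃ = ∑ i, p i * (x i - μ) ^ 3)
    (μ₄ : ℝ) (hμ₄ : μ₄ = ∑ i, p i * (x i - μ) ^ 4)
    (hpos : 0 < μ₂) :
    μ₄ / μ₂ ^ 2 - μ₃ ^ 2 / μ₂ ^ 3 ≤ (M - m) ^ 2 / (4 * μ₂) := by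
  obtain ⟨b, hb⟩ : ∃ b, b = (m + M) / 2 - μ := ⟨_, rfl⟩
  have hquad : μ₄ - 2 * b * μ₃ + b ^ 2 * μ₂ ≤ (M - m) ^ 2 / 4 * μ₂ := by
    rw [hμ₂, hμ₃, hμ₄]
    simp only [Finset.mul_sum, ← Finset.sum_sub_distrib, ← Finset.sum_add_distrib]
    refine Finset.sum_le_sum fun i _ => ?_
    have hdev : (x i - μ - b) ^ 2 ≤ (M - m) ^ 2 / 4 := by
      have h := mul_nonneg (sub_nonneg.2 (hx i).1) (sub_nonneg.2 (hx i).2)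
      rw [hb]
      linarith
    have h := mul_le_mul_of_nonneg_left hdev (mul_nonneg (hp i) (sq_nonneg (x i - μ)))
    linarith
  have hmul := mul_le_mul_of_nonneg_right hquad hpos.le
  have hkey : μ₄ * μ₂ - μ₃ ^ 2 ≤ (M - m) ^ 2 / 4 * μ₂ ^ 2 := by
    linarith [sq_nonneg (b * μ₂ - μ₃)]
  calc μ₄ / μ₂ ^ 2 - μ₃ ^ 2 / μ₂ ^ 3 = (μ₄ * μ₂ - μ₃ ^ 2) / μ₂ ^ 3 := by field_simp
    _ ≤ ((M - m) ^ 2 / 4 * μ₂ ^ 2) / μ₂ ^ 3 := by gcongr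
    _ = (M - m) ^ 2 / (4 * μ₂) := by field_simp
end

section
/- Let x_1,…,x_n be real numbers with m ≤ x_i ≤ M for all i and with positive variance m₂ > 0. Then the kurtosis minus the squared skewness is at most one quarter of the squared studentized range: α₄ − α₃² ≤ q²/4, i.e., m₄/m₂² − m₃²/m₂³ ≤ (M−m)²/(4m₂). -/
/-- **Corollary 2.5** (inequality (2.16)): for real numbers `x 1, …, x n` in
`[m, M]` with positive variance, `α₄ − α₃² ≤ q²/4`, i.e.
`m₄/m₂² − m₃²/m₂³ ≤ (M−m)²/(4m₂)`. -/
theorem kurtosis_sub_skewness_sq_le_studentized_range_sq {n : ℕ}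
    (x : Fin n → ℝ) (m M : ℝ)
    (hx : ∀ i, x i ∈ Set.Icc m M)
    (mean : ℝ) (hmean : mean = (1 / n) * ∑ i, x i)
    (m₂ : ℝ) (hm₂ : m₂ = (1 / n) * ∑ i, (x i - mean) ^ 2)
    (m₃ : ℝ) (hm₃ : m₃ = (1 / n) * ∑ i, (x i - mean) ^ 3)
    (m₄ : ℝ) (hm₄ : m₄ = (1 / n) * ∑ i, (x i - mean) ^ 4)
    (hpos : 0 < m₂) :
    m₄ / m₂ ^ 2 - m₃ ^ 2 / m₂ ^ 3 ≤ (M - m) ^ 2 / (4 * m₂) := by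
  obtain ⟨c, hc⟩ : ∃ c, c = (m + M) / 2 - mean := ⟨_, rfl⟩
  have key : m₄ - 2 * c * m₃ + c ^ 2 * m₂ ≤ (M - m) ^ 2 / 4 * m₂ := by
    have hsum : m₄ - 2 * c * m₃ + c ^ 2 * m₂
        = (1 / n) * ∑ i, (x i - mean) ^ 2 * (x i - mean - c) ^ 2 := by
      rw [hm₂, hm₃, hm₄]
      simp only [Finset.mul_sum, ← Finset.sum_sub_distrib, ← Finset.sum_add_distrib]
      exact Finset.sum_congr rfl fun i _ => by ring
    rw [hsum, hm₂, mul_left_comm, Finset.mul_sum _ _ ((M - m) ^ 2 / 4)]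
    simp only [mul_comm ((M - m) ^ 2 / 4)]
    gcongr with i
    obtain ⟨h1, h2⟩ := hx i
    rw [hc]
    nlinarith [mul_nonneg (sub_nonneg.2 h1) (sub_nonneg.2 h2)]
  have hdiff : (M - m) ^ 2 / (4 * m₂) - (m₄ / m₂ ^ 2 - m₃ ^ 2 / m₂ ^ 3)
      = (((M - m) ^ 2 / 4 * m₂ - (m₄ - 2 * c * m₃ + c ^ 2 * m₂)) * m₂
        + (m₃ - c * m₂) ^ 2) / m₂ ^ 3 := by
    field_simp
    ring
  rw [← sub_nonneg, hdiff]
  have := sub_nonneg.2 key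
  positivity
end

section
/- Let X be a discrete random variable taking values x_1,…,x_n in the interval [m,M] with probabilities p_1,…,p_n. Then the third central moment satisfies |μ₃| ≤ (M−m)³/(6√3). -/
/-- A centred random variable with values in `[a, b]` has third moment at most `k ^ 3 / 2`,
where `k = (b - a) / √3`. -/
theorem sum_mul_pow_three_le_of_centered {ι : Type*} [Fintype ι] (p y : ι → ℝ) (a b k : ℝ)
    (hp : ∀ i, 0 ≤ p i) (hp1 : ∑ i, p i = 1) (hy : ∀ i, y i ∈ Set.Icc a b)
    (hmean : ∑ i, p i * y i = 0) (hk : 0 ≤ k) (hkab : 3 * k ^ 2 = (b - a) ^ 2) :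
    ∑ i, p i * y i ^ 3 ≤ k ^ 3 / 2 := by
  have affine_sum (c d : ℝ) : ∑ i, p i * (c * y i + d) = d := by
    calc ∑ i, p i * (c * y i + d) = c * ∑ i, p i * y i + d * ∑ i, p i := by
          rw [Finset.mul_sum, Finset.mul_sum, ← Finset.sum_add_distrib]
          exact Finset.sum_congr rfl fun i _ => by ring
      _ = d := by rw [hmean, hp1]; ring
  have le_of_affine (c d : ℝ) (h : ∀ i, y i ^ 3 ≤ c * y i + d) : ∑ i, p i * y i ^ 3 ≤ d :=
    (Finset.sum_le_sum fun i _ => mul_le_mul_of_nonneg_left (h i) (hp i)).trans_eq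
      (affine_sum c d)
  have hb : 0 ≤ b := by
    have h := Finset.sum_le_sum fun i (_ : i ∈ Finset.univ) =>
      mul_le_mul_of_nonneg_left (hy i).2 (hp i)
    rwa [hmean, ← Finset.sum_mul, hp1, one_mul] at h
  rcases le_total (2 * a + b) 0 with hab | hab
  · refine (le_of_affine (3 / 4 * b ^ 2) (b ^ 3 / 4) fun i => ?_).trans ?_
    · nlinarith [mul_nonneg (sq_nonneg (y i + b / 2)) (sub_nonneg.2 (hy i).2)]
    · have hbk : b ^ 2 ≤ 4 / 3 * k ^ 2 := by nlinarith
      have hbk' : b ≤ 3 / 2 * k := abs_le_of_sq_le_sq' (by nlinarith) (by positivity) |>.2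
      nlinarith [mul_le_mul hbk hbk' hb (by positivity)]
  · refine (le_of_affine (a ^ 2 + a * b + b ^ 2) (-(a * b * (a + b))) fun i => ?_).trans ?_
    · have h : 0 ≤ y i + a + b := by linarith [(hy i).1]
      nlinarith [mul_nonneg (mul_nonneg (sub_nonneg.2 (hy i).1) (sub_nonneg.2 (hy i).2)) h]
    · have h : 0 ≤ (a + b - k) ^ 2 * (a + b + 2 * k) :=
        mul_nonneg (sq_nonneg _) (by linarith)
      linear_combination h / 4 - (a + b) / 4 * hkab


/-- **Theorem 2.3** (inequality (2.19)): the third central moment of a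
discrete random variable taking values in `[m, M]` satisfies
`|μ₃| ≤ (M−m)³/(6√3)`. -/
theorem abs_third_central_moment_le {n : ℕ} (p x : Fin n → ℝ) (m M : ℝ)
    (hp : ∀ i, 0 ≤ p i) (hp1 : ∑ i, p i = 1)
    (hx : ∀ i, x i ∈ Set.Icc m M)
    (μ : ℝ) (hμ : μ = ∑ i, p i * x i)
    (μ₃ : ℝ) (hμ₃ : μ₃ = ∑ i, p i * (x i - μ) ^ 3) :
    |μ₃| ≤ (M - m) ^ 3 / (6 * Real.sqrt 3) := by
  have h3 : Real.sqrt 3 ^ 2 = 3 := Real.sq_sqrt (by norm_num)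
  have h3pos : 0 < Real.sqrt 3 := by positivity
  have hmM : m ≤ M := by
    have : Nonempty (Fin n) := by
      by_contra h
      rw [not_nonempty_iff] at h
      simp at hp1
    obtain ⟨i⟩ := this
    exact (hx i).1.trans (hx i).2
  have hmean : ∑ i, p i * (x i - μ) = 0 := by
    simp only [mul_sub, Finset.sum_sub_distrib, ← Finset.sum_mul, hp1, ← hμ]
    ring
  set k := (M - m) / Real.sqrt 3 with hk
  have hk0 : 0 ≤ k := div_nonneg (sub_nonneg.2 hmM) h3pos.le
  have hMm : M - m = k * Real.sqrt 3 := by rw [hk, div_mul_cancel₀ _ h3pos.ne']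
  have hkab : 3 * k ^ 2 = (M - m) ^ 2 := by rw [hMm, mul_pow, h3]; ring
  have hbound : (M - m) ^ 3 / (6 * Real.sqrt 3) = k ^ 3 / 2 := by
    rw [hMm, div_eq_div_iff (by positivity) two_ne_zero]
    linear_combination 2 * k ^ 3 * Real.sqrt 3 * h3
  have upper := sum_mul_pow_three_le_of_centered p (fun i => x i - μ) (m - μ) (M - μ) k hp hp1
    (fun i => ⟨by linarith [(hx i).1], by linarith [(hx i).2]⟩) hmean hk0
    (by rw [hkab]; ring)
  have lower := sum_mul_pow_three_le_of_centered p (fun i => -(x i - μ)) (μ - M) (μ - m) k hp hp1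
    (fun i => ⟨by linarith [(hx i).2], by linarith [(hx i).1]⟩)
    (by simp only [mul_neg, Finset.sum_neg_distrib, hmean, neg_zero]) hk0
    (by rw [hkab]; ring)
  simp only [Odd.neg_pow (by decide : Odd 3), mul_neg, Finset.sum_neg_distrib, ← hμ₃] at lower
  rw [hbound, abs_le]
  exact ⟨by linarith, hμ₃.trans_le upper⟩
end

section
/- Let X be a discrete random variable taking values x_1,…,x_n in the interval [m,M] with probabilities p_1,…,p_n. Then μ₃² ≤ (M−m)²μ₂² − 4μ₂³. -/
/-- For a centered finite weighted family bounded above by `b`, the second and third moments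
satisfy `b μ₃ ≤ b² μ₂ - μ₂²`, provided `b` is positive. -/
theorem mul_third_moment_le_of_centered {ι : Type*} [Fintype ι] (p y : ι → ℝ) (b : ℝ)
    (hp : ∀ i, 0 ≤ p i) (hp1 : ∑ i, p i = 1) (hy : ∑ i, p i * y i = 0)
    (hb : ∀ i, y i ≤ b) (hb0 : 0 < b) :
    b * ∑ i, p i * y i ^ 3 ≤
      b ^ 2 * ∑ i, p i * y i ^ 2 - (∑ i, p i * y i ^ 2) ^ 2 := by
  set V := ∑ i, p i * y i ^ 2 with hV
  set T := ∑ i, p i * y i ^ 3 with hT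
  have hnonneg : 0 ≤ ∑ i, p i * ((b - y i) * (b * y i + V) ^ 2) :=
    Finset.sum_nonneg fun i _ =>
      mul_nonneg (hp i) (mul_nonneg (sub_nonneg.2 (hb i)) (sq_nonneg _))
  have hexpand : ∑ i, p i * ((b - y i) * (b * y i + V) ^ 2) =
      b * (b ^ 2 * V - V ^ 2 - b * T) := by
    calc
      _ = ∑ i, ((b ^ 3 - 2 * b * V) * (p i * y i ^ 2) + b * V ^ 2 * p i
            - b ^ 2 * (p i * y i ^ 3) + (2 * b ^ 2 * V - V ^ 2) * (p i * y i)) :=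
        Finset.sum_congr rfl fun i _ => by ring
      _ = _ := by
        rw [Finset.sum_add_distrib, Finset.sum_sub_distrib, Finset.sum_add_distrib]
        simp only [← Finset.mul_sum]
        rw [hp1, hy, ← hV, ← hT]
        ring
  rw [hexpand] at hnonneg
  linarith [nonneg_of_mul_nonneg_right hnonneg hb0]

/-- The second moment of a centered finite weighted family in `[-a, b]` is at most `a b`. -/
theorem second_moment_le_of_centered {ι : Type*} [Fintype ι] (p y : ι → ℝ) (a b : ℝ)
    (hp : ∀ i, 0 ≤ p i) (hp1 : ∑ i, p i = 1) (hy : ∑ i, p i * y i = 0)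
    (ha : ∀ i, -a ≤ y i) (hb : ∀ i, y i ≤ b) :
    ∑ i, p i * y i ^ 2 ≤ a * b := by
  have hnonneg : 0 ≤ ∑ i, p i * ((b - y i) * (y i + a)) :=
    Finset.sum_nonneg fun i _ =>
      mul_nonneg (hp i) (mul_nonneg (sub_nonneg.2 (hb i)) (by linarith [ha i]))
  have hexpand : ∑ i, p i * ((b - y i) * (y i + a)) = a * b - ∑ i, p i * y i ^ 2 := by
    calc
      _ = ∑ i, (a * b * p i - p i * y i ^ 2 + (b - a) * (p i * y i)) :=
        Finset.sum_congr rfl fun i _ => by ring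
      _ = _ := by
        rw [Finset.sum_add_distrib, Finset.sum_sub_distrib]
        simp only [← Finset.mul_sum]
        rw [hp1, hy]
        ring
  linarith

/-- The bound on the square of the third moment of a centered family when that moment is
nonnegative. -/
theorem third_moment_sq_le_of_centered {ι : Type*} [Fintype ι] (p y : ι → ℝ) (a b : ℝ)
    (hp : ∀ i, 0 ≤ p i) (hp1 : ∑ i, p i = 1) (hy : ∑ i, p i * y i = 0)
    (ha : ∀ i, -a ≤ y i) (hb : ∀ i, y i ≤ b) (hT : 0 ≤ ∑ i, p i * y i ^ 3) :
    (∑ i, p i * y i ^ 3) ^ 2 ≤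
      (a + b) ^ 2 * (∑ i, p i * y i ^ 2) ^ 2 - 4 * (∑ i, p i * y i ^ 2) ^ 3 := by
  have hbT := mul_third_moment_le_of_centered p y b hp hp1 hy hb
  have hVab := second_moment_le_of_centered p y a b hp hp1 hy ha hb
  have hTV : ∑ i, p i * y i ^ 3 ≤ b * ∑ i, p i * y i ^ 2 := by
    rw [Finset.mul_sum]
    refine Finset.sum_le_sum fun i _ => ?_
    nlinarith [mul_nonneg (mul_nonneg (hp i) (sq_nonneg (y i))) (sub_nonneg.2 (hb i))]
  have hV : 0 ≤ ∑ i, p i * y i ^ 2 :=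
    Finset.sum_nonneg fun i _ => mul_nonneg (hp i) (sq_nonneg _)
  have hb0 : 0 ≤ b := by
    calc
      0 = ∑ i, p i * y i := hy.symm
      _ ≤ ∑ i, p i * b := Finset.sum_le_sum fun i _ => mul_le_mul_of_nonneg_left (hb i) (hp i)
      _ = b := by rw [← Finset.sum_mul, hp1, one_mul]
  generalize ∑ i, p i * y i ^ 2 = V at *
  generalize ∑ i, p i * y i ^ 3 = T at *
  rcases hb0.eq_or_lt with rfl | hbpos
  · have hV0 : V = 0 := by linarith
    have hT0 : T = 0 := by linarith
    simp [hV0, hT0]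
  · have hsq : (b * T) ^ 2 ≤ (b ^ 2 * V - V ^ 2) ^ 2 :=
      pow_le_pow_left₀ (mul_nonneg hb0 hT) (hbT hbpos) 2
    have hsum : (b ^ 2 + V) ^ 2 ≤ (b * (a + b)) ^ 2 :=
      pow_le_pow_left₀ (by positivity) (by linarith) 2
    have hmul := mul_le_mul_of_nonneg_left hsum (sq_nonneg V)
    refine le_of_mul_le_mul_left ?_ (pow_pos hbpos 2)
    linarith

/-- Inequality (2.20): `μ₃² ≤ (M−m)²μ₂² − 4μ₂³` for a discrete random
variable taking values in `[m, M]`. -/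
theorem third_central_moment_sq_le {n : ℕ} (p x : Fin n → ℝ) (m M : ℝ)
    (hp : ∀ i, 0 ≤ p i) (hp1 : ∑ i, p i = 1)
    (hx : ∀ i, x i ∈ Set.Icc m M)
    (μ : ℝ) (hμ : μ = ∑ i, p i * x i)
    (μ₂ : ℝ) (hμ₂ : μ₂ = ∑ i, p i * (x i - μ) ^ 2)
    (μ₃ : ℝ) (hμ₃ : μ₃ = ∑ i, p i * (x i - μ) ^ 3) :
    μ₃ ^ 2 ≤ (M - m) ^ 2 * μ₂ ^ 2 - 4 * μ₂ ^ 3 := by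
  have hy : ∑ i, p i * (x i - μ) = 0 := by
    simp only [mul_sub, Finset.sum_sub_distrib, ← Finset.sum_mul]
    rw [hp1, ← hμ, one_mul, sub_self]
  have hlo : ∀ i, -(μ - m) ≤ x i - μ := fun i => by linarith [(hx i).1]
  have hhi : ∀ i, x i - μ ≤ M - μ := fun i => by linarith [(hx i).2]
  rcases le_total 0 μ₃ with hT | hT
  · have h := third_moment_sq_le_of_centered p (fun i => x i - μ) (μ - m) (M - μ)
      hp hp1 hy hlo hhi (hμ₃ ▸ hT)
    rw [← hμ₂, ← hμ₃] at h
    linarith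
  · have hcube : ∑ i, p i * (-(x i - μ)) ^ 3 = -μ₃ := by
      rw [hμ₃, ← Finset.sum_neg_distrib]
      exact Finset.sum_congr rfl fun i _ => by ring
    have h := third_moment_sq_le_of_centered p (fun i => -(x i - μ)) (M - μ) (μ - m)
      hp hp1 (by simp only [mul_neg, Finset.sum_neg_distrib, hy, neg_zero])
      (fun i => neg_le_neg (hhi i)) (fun i => by linarith [hlo i])
      (by rw [hcube]; linarith)
    simp only [hcube, neg_sq (x _ - μ)] at h
    rw [← hμ₂] at h
    linarith
end

section
/- Let n ≥ 3 and let x_1,…,x_n be real numbers with minimum value m and maximum value M. Then for every positive integer r, the central moment of order 2r satisfies m_{2r} ≥ (M−m)^{2r}/(2^{2r−1}n) + (n/(n−2))^{r−1}·(m₂ − (M−m)²/(2n))^r. -/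
/-- The graph of `t ↦ t ^ (k + 1)` on `[0, ∞)` lies above its tangent lines. -/
theorem succ_mul_pow_mul_sub_le_pow_sub_pow {x y : ℝ} (hx : 0 ≤ x) (hy : 0 ≤ y) (k : ℕ) :
    (k + 1) * y ^ k * (x - y) ≤ x ^ (k + 1) - y ^ (k + 1) := by
  induction k with
  | zero => simp
  | succ k ih =>
    have h₁ := mul_le_mul_of_nonneg_left ih hx
    have h₂ : 0 ≤ (k + 1) * y ^ k * (x - y) ^ 2 := by positivity
    push_cast
    linear_combination h₁ + h₂

/-- Spreading two weighted points apart while keeping their weighted sum increases the weighted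
sum of powers. -/
theorem mul_pow_add_mul_pow_le_of_spread {α β u v p q : ℝ} (hα : 0 ≤ α) (hβ : 0 ≤ β)
    (hu : 0 ≤ u) (huv : u ≤ v) (hvq : v ≤ q) (hqp : q ≤ p)
    (h : α * p + β * u = α * q + β * v) (k : ℕ) :
    α * q ^ (k + 1) + β * v ^ (k + 1) ≤ α * p ^ (k + 1) + β * u ^ (k + 1) := by
  have hv := hu.trans huv
  have hq := hv.trans hvq
  have h₁ := mul_le_mul_of_nonneg_left
    (succ_mul_pow_mul_sub_le_pow_sub_pow (hq.trans hqp) hq k) hα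
  have h₂ := mul_le_mul_of_nonneg_left (succ_mul_pow_mul_sub_le_pow_sub_pow hu hv k) hβ
  have h₃ : 0 ≤ (k + 1) * (q ^ k - v ^ k) * (α * (p - q)) :=
    mul_nonneg (mul_nonneg (by positivity) (sub_nonneg.2 (pow_le_pow_left₀ hv hvq k)))
      (mul_nonneg hα (sub_nonneg.2 hqp))
  linear_combination h₁ + h₂ + h₃ - (k + 1) * v ^ k * h

/-- Popoviciu's inequality for centered data lying in `[b, a]`. -/
theorem sum_sq_le_card_mul_sq_div_four {ι : Type*} [Fintype ι] {y : ι → ℝ} {a b : ℝ}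
    (hy : ∑ i, y i = 0) (hb : ∀ i, b ≤ y i) (ha : ∀ i, y i ≤ a) :
    ∑ i, y i ^ 2 ≤ Fintype.card ι * ((a - b) ^ 2 / 4) := by
  have h : ∑ i, y i ^ 2 ≤ ∑ i, ((a + b) * y i + (a - b) ^ 2 / 4) :=
    Finset.sum_le_sum fun i _ => by
      nlinarith [mul_nonneg (sub_nonneg.2 (ha i)) (sub_nonneg.2 (hb i)), sq_nonneg (a + b)]
  simpa [Finset.sum_add_distrib, ← Finset.mul_sum, hy] using h

theorem exists_ne_attaining_min_max {ι α : Type*} [Nontrivial ι] [PartialOrder α] {x : ι → α}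
    {m M : α} (hm : ∀ i, m ≤ x i) (hM : ∀ i, x i ≤ M) (hm' : ∃ i, x i = m)
    (hM' : ∃ i, x i = M) : ∃ i j, i ≠ j ∧ x i = m ∧ x j = M := by
  obtain ⟨i, hi⟩ := hm'
  obtain ⟨j, hj⟩ := hM'
  by_cases hij : i = j
  · obtain ⟨l, hl⟩ := exists_ne i
    have hmM : m = M := by rw [← hi, ← hj, hij]
    exact ⟨i, l, hl.symm, hi, le_antisymm (hM l) (hmM ▸ hm l)⟩
  · exact ⟨i, j, hij, hi, hj⟩

/-- Lower bound for the sum of even powers of centered data with range `[b, a]`. -/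
theorem le_sum_even_pow_of_sum_eq_zero {ι : Type*} [Fintype ι] (hι : 3 ≤ Fintype.card ι)
    {y : ι → ℝ} {a b : ℝ} (hy : ∑ i, y i = 0) (hb : ∀ i, b ≤ y i) (ha : ∀ i, y i ≤ a)
    {i j : ι} (hij : i ≠ j) (hi : y i = b) (hj : y j = a) (k : ℕ) :
    2 * ((a - b) ^ 2 / 4) ^ (k + 1) + ((Fintype.card ι : ℝ) - 2) *
        ((∑ l, y l ^ 2 - (a - b) ^ 2 / 2) / ((Fintype.card ι : ℝ) - 2)) ^ (k + 1) ≤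
      ∑ l, y l ^ (2 * (k + 1)) := by
  classical
  let s : Finset ι := (Finset.univ.erase i).erase j
  have hcard : (s.card : ℝ) = Fintype.card ι - 2 := by
    have h : s.card = Fintype.card ι - 1 - 1 := by
      rw [Finset.card_erase_of_mem (by simp [hij.symm]),
        Finset.card_erase_of_mem (Finset.mem_univ i), Finset.card_univ]
    have : s.card + 2 = Fintype.card ι := by omega
    rw [← this]; push_cast; ring
  have hsplit (f : ι → ℝ) : ∑ l, f l = f i + f j + ∑ l ∈ s, f l := by
    rw [add_assoc, Finset.add_sum_erase _ f (by simp [hij.symm]),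
      Finset.add_sum_erase _ f (Finset.mem_univ i)]
  have hpop := sum_sq_le_card_mul_sq_div_four hy hb ha
  have hι' : (3 : ℝ) ≤ Fintype.card ι := by exact_mod_cast hι
  set N : ℝ := (Fintype.card ι : ℝ) - 2 with hN
  have hNpos : 0 < N := by linarith
  have hcardι : (Fintype.card ι : ℝ) = N + 2 := by linarith
  have hpow : N * ((∑ l ∈ s, y l ^ 2) / N) ^ (k + 1) ≤ ∑ l ∈ s, y l ^ (2 * (k + 1)) := by
    have h := pow_sum_div_card_le_sum_pow (s := s) (f := fun l => y l ^ 2)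
      (fun l _ => sq_nonneg (y l)) k
    simp only [hcard, ← pow_mul] at h
    refine le_trans (le_of_eq ?_) h
    rw [div_pow, pow_succ N]
    field_simp
  have hends : 2 * ((a ^ 2 + b ^ 2) / 2) ^ (k + 1) ≤ b ^ (2 * (k + 1)) + a ^ (2 * (k + 1)) := by
    have h := add_pow_le (sq_nonneg b) (sq_nonneg a) (k + 1)
    rw [Nat.add_sub_cancel] at h
    rw [pow_mul, pow_mul, add_comm (a ^ 2), div_pow, pow_succ (2 : ℝ)]
    calc _ = (b ^ 2 + a ^ 2) ^ (k + 1) / 2 ^ k := by field_simp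
      _ ≤ _ := by rw [div_le_iff₀' (by positivity)]; exact h
  have hsq := hsplit fun l => y l ^ 2
  simp only [hi, hj] at hsq
  have hspread := mul_pow_add_mul_pow_le_of_spread (α := 2) (β := N)
    (u := (∑ l ∈ s, y l ^ 2) / N) (v := (∑ l, y l ^ 2 - (a - b) ^ 2 / 2) / N)
    (p := (a ^ 2 + b ^ 2) / 2) (q := (a - b) ^ 2 / 4) (by norm_num) hNpos.le
    (div_nonneg (Finset.sum_nonneg fun l _ => sq_nonneg (y l)) hNpos.le)
    (div_le_div_of_nonneg_right (by nlinarith [sq_nonneg (a + b)]) hNpos.le)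
    (by
      rw [div_le_iff₀ hNpos]
      rw [hcardι] at hpop
      linarith)
    (by nlinarith [sq_nonneg (a + b)])
    (by
      rw [mul_div_cancel₀ _ hNpos.ne', mul_div_cancel₀ _ hNpos.ne']
      linarith)
    k
  have htotal := hsplit fun l => y l ^ (2 * (k + 1))
  simp only [hi, hj] at htotal
  linarith

/-- **Theorem 2.4** (inequality (2.22)): for `n ≥ 3` real numbers with
minimum `m` and maximum `M`, and every positive integer `r`,
`m_{2r} ≥ (M−m)^{2r}/(2^{2r−1}n) + (n/(n−2))^{r−1}(m₂ − (M−m)²/(2n))^r`. -/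
theorem central_moment_two_r_lower_bound {n : ℕ} (hn : 3 ≤ n)
    (x : Fin n → ℝ) (m M : ℝ)
    (hm : ∀ i, m ≤ x i) (hM : ∀ i, x i ≤ M)
    (hm' : ∃ i, x i = m) (hM' : ∃ i, x i = M)
    (r : ℕ) (hr : 1 ≤ r)
    (mean : ℝ) (hmean : mean = (1 / n) * ∑ i, x i)
    (m₂ : ℝ) (hm₂ : m₂ = (1 / n) * ∑ i, (x i - mean) ^ 2)
    (m₂r : ℝ) (hm₂r : m₂r = (1 / n) * ∑ i, (x i - mean) ^ (2 * r)) :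
    (M - m) ^ (2 * r) / (2 ^ (2 * r - 1) * n) +
      ((n : ℝ) / ((n : ℝ) - 2)) ^ (r - 1) * (m₂ - (M - m) ^ 2 / (2 * n)) ^ r
      ≤ m₂r := by
  obtain ⟨k, rfl⟩ : ∃ k, r = k + 1 := ⟨r - 1, by omega⟩
  have : Nontrivial (Fin n) := Fin.nontrivial_iff_two_le.2 (by omega)
  obtain ⟨i, j, hij, hi, hj⟩ := exists_ne_attaining_min_max hm hM hm' hM'
  have hn' : (3 : ℝ) ≤ n := by exact_mod_cast hn
  have hn₀ : (n : ℝ) ≠ 0 := by positivity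
  have hn₂ : (n : ℝ) - 2 ≠ 0 := by linarith
  have hcentered : ∑ l, (x l - mean) = 0 := by
    rw [Finset.sum_sub_distrib, hmean]
    simp [hn₀]
  have key := le_sum_even_pow_of_sum_eq_zero (by simpa using hn) hcentered
    (fun l => sub_le_sub_right (hm l) mean) (fun l => sub_le_sub_right (hM l) mean) hij
    (by rw [hi]) (by rw [hj]) k
  have hsum : ∑ l, (x l - mean) ^ 2 = n * m₂ := by rw [hm₂]; field_simp
  rw [hsum, Fintype.card_fin, sub_sub_sub_cancel_right] at key
  rw [hm₂r, one_div, ← div_eq_inv_mul]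
  refine le_trans (le_of_eq ?_) (div_le_div_of_nonneg_right key (by positivity))
  have hmid : m₂ - (M - m) ^ 2 / (2 * n) =
      (n * m₂ - (M - m) ^ 2 / 2) / (n - 2) * ((n - 2) / n) := by field_simp
  have hexp : 2 * (k + 1) - 1 = 2 * k + 1 := by omega
  rw [hmid, hexp, Nat.add_sub_cancel, add_div]
  congr 1
  · rw [div_pow, ← pow_mul, show (4 : ℝ) = 2 ^ 2 by norm_num, ← pow_mul,
      show 2 * (k + 1) = 2 * k + 1 + 1 by ring, pow_succ (2 : ℝ) (2 * k + 1)]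
    field_simp
  · generalize (n * m₂ - (M - m) ^ 2 / 2) / ((n : ℝ) - 2) = v
    rw [mul_pow, pow_succ (((n : ℝ) - 2) / n), div_pow, div_pow]
    field_simp
end

section
/- Let x_1,…,x_n be real numbers (n ≥ 2) with minimum value m and maximum value M. Then for every positive integer r, the central moment of order 2r satisfies m_{2r} ≥ (M−m)^{2r}/(2^{2r−1}n). (For r = 1 this is Nagy's inequality.) -/
/-- For even `k`, `(a - b) ^ k` is at most `2 ^ (k - 1)` times the sum of the `k`-th powers. -/
lemma sub_pow_le_of_even {k : ℕ} (hk : Even k) (a b : ℝ) :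
    (a - b) ^ k ≤ 2 ^ (k - 1) * (a ^ k + b ^ k) := by
  simpa [sub_eq_add_neg, hk.neg_pow] using hk.add_pow_le (a := a) (b := -b)


/-- Inequality (2.28) (generalized Nagy inequality): for `n ≥ 2` real numbers
with minimum `m` and maximum `M`, and every positive integer `r`,
`m_{2r} ≥ (M−m)^{2r}/(2^{2r−1}n)`. -/
theorem nagy_inequality_generalized {n : ℕ} (hn : 2 ≤ n)
    (x : Fin n → ℝ) (m M : ℝ)
    (hm : ∀ i, m ≤ x i) (hM : ∀ i, x i ≤ M)
    (hm' : ∃ i, x i = m) (hM' : ∃ i, x i = M)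
    (r : ℕ) (hr : 1 ≤ r)
    (mean : ℝ) (hmean : mean = (1 / n) * ∑ i, x i)
    (m₂r : ℝ) (hm₂r : m₂r = (1 / n) * ∑ i, (x i - mean) ^ (2 * r)) :
    (M - m) ^ (2 * r) / (2 ^ (2 * r - 1) * n) ≤ m₂r := by
  have hn0 : (0 : ℝ) < n := by exact_mod_cast (by omega : 0 < n)
  have hk : Even (2 * r) := even_two_mul r
  obtain ⟨i, hi⟩ := hm'
  obtain ⟨j, hj⟩ := hM'
  have key : (M - m) ^ (2 * r) ≤ 2 ^ (2 * r - 1) * ∑ l, (x l - mean) ^ (2 * r) := by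
    by_cases hij : j = i
    · have hMm : M - m = 0 := by rw [← hi, ← hj, hij, sub_self]
      rw [hMm, zero_pow (by omega)]
      exact mul_nonneg (by positivity) (Finset.sum_nonneg fun l _ => hk.pow_nonneg _)
    · have hpair : (x j - mean) ^ (2 * r) + (x i - mean) ^ (2 * r)
          ≤ ∑ l, (x l - mean) ^ (2 * r) := by
        rw [← Finset.sum_pair (f := fun l => (x l - mean) ^ (2 * r)) hij]
        exact Finset.sum_le_sum_of_subset_of_nonneg (Finset.subset_univ _)
          fun l _ _ => hk.pow_nonneg _
      calc (M - m) ^ (2 * r) = ((x j - mean) - (x i - mean)) ^ (2 * r) := by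
            rw [sub_sub_sub_cancel_right, hi, hj]
        _ ≤ 2 ^ (2 * r - 1) * ((x j - mean) ^ (2 * r) + (x i - mean) ^ (2 * r)) :=
            sub_pow_le_of_even hk _ _
        _ ≤ _ := by gcongr
  rw [hm₂r, div_le_iff₀ (by positivity)]
  calc (M - m) ^ (2 * r) ≤ 2 ^ (2 * r - 1) * ∑ l, (x l - mean) ^ (2 * r) := key
    _ = _ := by field_simp
end

section
/- Let φ be a positive unital linear functional on the n×n complex matrices and let A be a Hermitian n×n complex matrix. Set B = A − φ(A)·I. Then φ(B⁴) ≤ spd(A)⁴/12. -/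
open ComplexOrder

/-- The secant line of `x ↦ x ^ 4` through the points at `m` and `M` lies above the function
on the interval `[m, M]`. -/
lemma pow_four_le_secant {m M x : ℝ} (hm : m ≤ x) (hM : x ≤ M) :
    x ^ 4 ≤ (M + m) * (M ^ 2 + m ^ 2) * x - m * M * (M ^ 2 + M * m + m ^ 2) := by
  have h : 0 ≤ x ^ 2 + x * (m + M) + (m ^ 2 + m * M + M ^ 2) := by
    nlinarith [sq_nonneg (x + m), sq_nonneg (x + M), sq_nonneg (m + M)]
  nlinarith [mul_nonneg (mul_nonneg (sub_nonneg.2 hM) (sub_nonneg.2 hm)) h]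

lemma secant_intercept_le (m M : ℝ) :
    -(m * M * (M ^ 2 + M * m + m ^ 2)) ≤ (M - m) ^ 4 / 12 := by
  nlinarith [sq_nonneg ((M - m) ^ 2 + 6 * (m * M))]

/-- A real quartic combination of a Hermitian matrix is positive semidefinite when the
corresponding polynomial is nonnegative on the eigenvalues. -/
lemma Matrix.IsHermitian.posSemidef_quartic {n : Type*} [Fintype n] [DecidableEq n]
    {A : Matrix n n ℂ} (hA : A.IsHermitian) (μ a b c : ℝ)
    (h : ∀ i, 0 ≤ a + b * (hA.eigenvalues i - μ) + c * (hA.eigenvalues i - μ) ^ 4) :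
    ((a : ℂ) • (1 : Matrix n n ℂ) + (b : ℂ) • (A - (μ : ℂ) • (1 : Matrix n n ℂ)) +
      (c : ℂ) • (A - (μ : ℂ) • (1 : Matrix n n ℂ)) ^ 4).PosSemidef := by
  set T := Unitary.conjStarAlgAut ℂ (Matrix n n ℂ) hA.eigenvectorUnitary with hT
  have hspec : A = T (diagonal (fun i => (hA.eigenvalues i : ℂ))) := hA.spectral_theorem
  have hq : (a : ℂ) • (1 : Matrix n n ℂ) + (b : ℂ) • (A - (μ : ℂ) • (1 : Matrix n n ℂ)) +
      (c : ℂ) • (A - (μ : ℂ) • (1 : Matrix n n ℂ)) ^ 4 =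
      T (diagonal (fun i => ((a + b * (hA.eigenvalues i - μ) +
        c * (hA.eigenvalues i - μ) ^ 4 : ℝ) : ℂ))) := by
    have hd : diagonal (fun i => ((a + b * (hA.eigenvalues i - μ) +
        c * (hA.eigenvalues i - μ) ^ 4 : ℝ) : ℂ)) =
        (a : ℂ) • (1 : Matrix n n ℂ) +
        (b : ℂ) • (diagonal (fun i => (hA.eigenvalues i : ℂ)) - (μ : ℂ) • (1 : Matrix n n ℂ)) +
        (c : ℂ) • (diagonal (fun i => (hA.eigenvalues i : ℂ)) -
          (μ : ℂ) • (1 : Matrix n n ℂ)) ^ 4 := by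
      have hs : diagonal (fun i => (hA.eigenvalues i : ℂ)) - (μ : ℂ) • (1 : Matrix n n ℂ) =
          diagonal (fun i => (hA.eigenvalues i : ℂ) - μ) := by
        rw [smul_one_eq_diagonal, diagonal_sub]
      rw [hs, diagonal_pow, smul_one_eq_diagonal, ← diagonal_smul, ← diagonal_smul,
        diagonal_add, diagonal_add]
      congr 1
      ext i
      simp
    rw [hd]
    simp only [map_add, map_smul, map_sub, map_pow, map_one, ← hspec]
  rw [hq, hT, Unitary.conjStarAlgAut_apply]
  refine PosSemidef.mul_mul_conjTranspose_same (PosSemidef.diagonal fun i => ?_) _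
  exact Complex.zero_le_real.2 (h i)

theorem positive_functional_fourth_moment_le_spread {n : ℕ} (hn : 0 < n)
    (φ : Matrix (Fin n) (Fin n) ℂ →ₗ[ℂ] ℂ)
    (hpos : ∀ P : Matrix (Fin n) (Fin n) ℂ, P.PosSemidef → 0 ≤ φ P)
    (hunital : φ 1 = 1)
    (A : Matrix (Fin n) (Fin n) ℂ) (hA : A.IsHermitian)
    (B : Matrix (Fin n) (Fin n) ℂ) (hB : B = A - φ A • 1)
    (spd : ℝ)
    (hspd : spd = ⨆ i, ⨆ j, |hA.eigenvalues i - hA.eigenvalues j|) :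
    φ (B ^ 4) ≤ ((spd ^ 4 / 12 : ℝ) : ℂ) := by
  have : Nonempty (Fin n) := ⟨⟨0, hn⟩⟩
  obtain ⟨i, hi⟩ := Finite.exists_min hA.eigenvalues
  obtain ⟨j, hj⟩ := Finite.exists_max hA.eigenvalues
  have hle : hA.eigenvalues j - hA.eigenvalues i ≤ spd := by
    rw [hspd]
    refine (le_abs_self _).trans ?_
    exact (le_ciSup (f := fun l => |hA.eigenvalues j - hA.eigenvalues l|)
      (Set.finite_range _).bddAbove i).trans
      (le_ciSup (f := fun k => ⨆ l, |hA.eigenvalues k - hA.eigenvalues l|)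
        (Set.finite_range _).bddAbove j)
  have hreal : ((φ A).re : ℂ) = φ A := by
    have h := hpos _ (hA.posSemidef_quartic (hA.eigenvalues i) 0 1 0
      fun k => by simpa using hi k)
    simp only [Complex.ofReal_zero, Complex.ofReal_one, zero_smul, one_smul, zero_add, add_zero,
      map_sub, map_smul, hunital, smul_eq_mul, mul_one] at h
    have him := (Complex.le_def.1 h).2
    apply Complex.ext <;> simp_all
  set μ := (φ A).re
  set m := hA.eigenvalues i - μ
  set M := hA.eigenvalues j - μ
  have hφB : φ B = 0 := by simp [hB, hunital]
  have h := hpos _ (hA.posSemidef_quartic μ (-(m * M * (M ^ 2 + M * m + m ^ 2)))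
    ((M + m) * (M ^ 2 + m ^ 2)) (-1) fun k => by
      have := pow_four_le_secant (sub_le_sub_right (hi k) μ) (sub_le_sub_right (hj k) μ)
      linarith)
  rw [hreal, ← hB] at h
  simp only [map_add, map_smul, hunital, hφB, smul_eq_mul, mul_one, mul_zero, add_zero,
    Complex.ofReal_neg, Complex.ofReal_one, neg_mul, one_mul] at h
  rw [← sub_eq_add_neg, sub_nonneg] at h
  refine h.trans ?_
  rw [← Complex.ofReal_neg, Complex.real_le_real]
  refine (secant_intercept_le m M).trans ?_
  have h0 : 0 ≤ M - m := by
    have := hi j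
    linarith
  have h1 : M - m ≤ spd := by linarith
  gcongr
end

section
/- Let φ be a positive unital linear functional on the n×n complex matrices and let A be a Hermitian n×n complex matrix. Set B = A − φ(A)·I. Then φ(B²)φ(B⁴) − φ(B²)³ − φ(B³)² ≤ spd(A)⁶/432. -/
open ComplexOrder

/-- A positive functional acts on the polynomials in a Hermitian matrix as integration against
nonnegative weights on the eigenvalues. -/
theorem exists_weights_of_positive_functional {n : ℕ}
    (φ : Matrix (Fin n) (Fin n) ℂ →ₗ[ℂ] ℂ)
    (hpos : ∀ P : Matrix (Fin n) (Fin n) ℂ, P.PosSemidef → 0 ≤ φ P)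
    (A : Matrix (Fin n) (Fin n) ℂ) (hA : A.IsHermitian) :
    ∃ w : Fin n → ℝ, (∀ i, 0 ≤ w i) ∧ ∀ (c : ℝ) (k : ℕ),
      φ ((A - (c : ℂ) • 1) ^ k) = ((∑ i, w i * (hA.eigenvalues i - c) ^ k : ℝ) : ℂ) := by
  set U : Matrix (Fin n) (Fin n) ℂ := (hA.eigenvectorUnitary : Matrix (Fin n) (Fin n) ℂ) with hU
  have hUU : star U * U = 1 := Unitary.coe_star_mul_self hA.eigenvectorUnitary
  have hUU' : U * star U = 1 := Unitary.coe_mul_star_self hA.eigenvectorUnitary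
  have hspec : A = U * Matrix.diagonal (fun i => (hA.eigenvalues i : ℂ)) * star U := by
    conv_lhs => rw [hA.spectral_theorem, Unitary.conjStarAlgAut_apply]
    rfl
  have hP (i : Fin n) : 0 ≤ φ (U * Matrix.diagonal (Pi.single i (1 : ℂ)) * star U) := by
    apply hpos
    have hd : (Matrix.diagonal (Pi.single i (1 : ℂ)) : Matrix (Fin n) (Fin n) ℂ).PosSemidef :=
      Matrix.PosSemidef.diagonal (Pi.single_nonneg.mpr zero_le_one)
    exact hd.mul_mul_conjTranspose_same U
  refine ⟨fun i => (φ (U * Matrix.diagonal (Pi.single i (1 : ℂ)) * star U)).re,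
    fun i => (Complex.le_def.mp (hP i)).1, fun c k => ?_⟩
  have hre (i : Fin n) : ((φ (U * Matrix.diagonal (Pi.single i (1 : ℂ)) * star U)).re : ℂ) =
      φ (U * Matrix.diagonal (Pi.single i (1 : ℂ)) * star U) :=
    Complex.ext rfl (by simpa using (Complex.le_def.mp (hP i)).2)
  have hshift : A - (c : ℂ) • 1 =
      U * Matrix.diagonal (fun i => (hA.eigenvalues i : ℂ) - c) * star U := by
    have : (Matrix.diagonal (fun i => (hA.eigenvalues i : ℂ) - c) : Matrix (Fin n) (Fin n) ℂ) =
        Matrix.diagonal (fun i => (hA.eigenvalues i : ℂ)) - (c : ℂ) • 1 := by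
      rw [← Matrix.diagonal_one, ← Matrix.diagonal_smul, Matrix.diagonal_sub]
      simp
    rw [this, mul_sub, sub_mul, ← hspec, mul_smul_comm, smul_mul_assoc, mul_one, hUU']
  have hpow (k : ℕ) : (A - (c : ℂ) • 1) ^ k =
      U * Matrix.diagonal (fun i => ((hA.eigenvalues i : ℂ) - c) ^ k) * star U := by
    induction k with
    | zero => simp [hUU']
    | succ k ih =>
      rw [pow_succ, ih, hshift]
      calc _ = U * Matrix.diagonal (fun i => ((hA.eigenvalues i : ℂ) - c) ^ k) * (star U * U) *
              Matrix.diagonal (fun i => (hA.eigenvalues i : ℂ) - c) * star U := by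
            simp only [mul_assoc]
        _ = _ := by
            rw [hUU, mul_one, mul_assoc U, Matrix.diagonal_mul_diagonal]
            simp only [pow_succ]
  have hdiag (d : Fin n → ℂ) : U * Matrix.diagonal d * star U =
      ∑ i, d i • (U * Matrix.diagonal (Pi.single i (1 : ℂ)) * star U) := by
    simp only [← smul_mul_assoc, ← Finset.sum_mul]
    congr 1
    ext a b
    simp [Matrix.sum_apply, Pi.single_apply, mul_comm]
  rw [hpow, hdiag, map_sum]
  push_cast
  refine Finset.sum_congr rfl fun i _ => ?_
  rw [map_smul, smul_eq_mul, hre, mul_comm]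

/-- The determinant of second order central moments of a probability distribution on `[c - h, c + h]`
is at most `4 h ^ 6 / 27`. -/
theorem central_moment_det_le {ι : Type*} [Fintype ι] (w x : ι → ℝ) (hw : ∀ i, 0 ≤ w i)
    (hw1 : ∑ i, w i = 1) (m c h : ℝ) (hm : ∑ i, w i * (x i - m) = 0)
    (hx : ∀ i, |x i - c| ≤ h) :
    (∑ i, w i * (x i - m) ^ 2) * (∑ i, w i * (x i - m) ^ 4) - (∑ i, w i * (x i - m) ^ 2) ^ 3 -
      (∑ i, w i * (x i - m) ^ 3) ^ 2 ≤ 4 * h ^ 6 / 27 := by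
  set a := m - c with ha
  set p := ∑ i, w i * (x i - c) ^ 2 with hp
  set q := ∑ i, w i * (x i - c) ^ 3 with hq
  set r := ∑ i, w i * (x i - c) ^ 4 with hr
  have h1 : ∑ i, w i * (x i - c) = a := by
    have : ∑ i, w i * (x i - c) = ∑ i, w i * (x i - m) + a * ∑ i, w i := by
      rw [Finset.mul_sum, ← Finset.sum_add_distrib]
      exact Finset.sum_congr rfl fun i _ => by ring
    rw [this, hm, hw1]; ring
  have expand (f : ι → ℝ) (k0 k1 k2 k3 k4 : ℝ) (hf : ∀ i, f i = k0 + k1 * (x i - c) +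
      k2 * (x i - c) ^ 2 + k3 * (x i - c) ^ 3 + k4 * (x i - c) ^ 4) :
      ∑ i, w i * f i = k0 + k1 * a + k2 * p + k3 * q + k4 * r := by
    calc _ = k0 * ∑ i, w i + k1 * ∑ i, w i * (x i - c) + k2 * p + k3 * q + k4 * r := by
          simp only [hp, hq, hr, Finset.mul_sum, ← Finset.sum_add_distrib]
          exact Finset.sum_congr rfl fun i _ => by rw [hf]; ring
      _ = _ := by rw [hw1, h1, mul_one]
  rw [expand (fun i => (x i - m) ^ 2) (a ^ 2) (-2 * a) 1 0 0 fun i => by rw [ha]; ring,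
    expand (fun i => (x i - m) ^ 3) (-a ^ 3) (3 * a ^ 2) (-3 * a) 1 0 fun i => by rw [ha]; ring,
    expand (fun i => (x i - m) ^ 4) (a ^ 4) (-4 * a ^ 3) (6 * a ^ 2) (-4 * a) 1
      fun i => by rw [ha]; ring]
  have hp0 : 0 ≤ p := Finset.sum_nonneg fun i _ => mul_nonneg (hw i) (sq_nonneg _)
  have hvar : p ^ 2 ≤ r := by
    have h0 : 0 ≤ ∑ i, w i * ((x i - c) ^ 2 - p) ^ 2 :=
      Finset.sum_nonneg fun i _ => mul_nonneg (hw i) (sq_nonneg _)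
    rw [expand _ (p ^ 2) 0 (-2 * p) 0 1 fun i => by ring] at h0
    linarith
  have hrp : r ≤ h ^ 2 * p := by
    rw [hr, hp, Finset.mul_sum]
    refine Finset.sum_le_sum fun i _ => ?_
    have hsq : (x i - c) ^ 2 ≤ h ^ 2 := sq_le_sq' (abs_le.mp (hx i)).1 (abs_le.mp (hx i)).2
    have := mul_le_mul_of_nonneg_left hsq (mul_nonneg (hw i) (sq_nonneg (x i - c)))
    linarith
  have hdet : p * r - p ^ 3 ≤ 4 * h ^ 6 / 27 := by
    have h2 : p * r ≤ p * (h ^ 2 * p) := mul_le_mul_of_nonneg_left hrp hp0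
    have h3 : 0 ≤ (p - 2 * h ^ 2 / 3) ^ 2 * (p + h ^ 2 / 3) := by positivity
    linarith
  have h4 : 0 ≤ (q - a * p) ^ 2 + a ^ 2 * (r - p ^ 2) :=
    add_nonneg (sq_nonneg _) (mul_nonneg (sq_nonneg _) (sub_nonneg.mpr hvar))
  linarith

/-- Finitely many reals at pairwise distance at most `s` lie in an interval of length `s`. -/
theorem exists_center_of_pairwise_dist_le {ι : Type*} [Finite ι] [Nonempty ι] (x : ι → ℝ)
    (s : ℝ) (hs : ∀ i j, |x i - x j| ≤ s) : ∃ c, ∀ i, |x i - c| ≤ s / 2 := by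
  obtain ⟨M, hM⟩ := Finite.exists_max x
  obtain ⟨N, hN⟩ := Finite.exists_min x
  refine ⟨(x M + x N) / 2, fun i => abs_le.mpr ?_⟩
  have h1 := (abs_le.mp (hs M N)).2
  have h2 := hM i
  have h3 := hN i
  constructor <;> linarith

/-- **Theorem 3.1**, inequality (3.6): if `φ` is a positive unital linear
functional on the `n × n` complex matrices, `A` is Hermitian and
`B = A − φ(A)·I`, then `φ(B²)φ(B⁴) − φ(B²)³ − φ(B³)² ≤ spd(A)⁶/432`. -/
theorem positive_functional_moment_det_le_spread {n : ℕ} (hn : 0 < n)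
    (φ : Matrix (Fin n) (Fin n) ℂ →ₗ[ℂ] ℂ)
    (hpos : ∀ P : Matrix (Fin n) (Fin n) ℂ, P.PosSemidef → 0 ≤ φ P)
    (hunital : φ 1 = 1)
    (A : Matrix (Fin n) (Fin n) ℂ) (hA : A.IsHermitian)
    (B : Matrix (Fin n) (Fin n) ℂ) (hB : B = A - φ A • 1)
    (spd : ℝ)
    (hspd : spd = ⨆ i, ⨆ j, |hA.eigenvalues i - hA.eigenvalues j|) :
    φ (B ^ 2) * φ (B ^ 4) - φ (B ^ 2) ^ 3 - φ (B ^ 3) ^ 2 ≤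
      ((spd ^ 6 / 432 : ℝ) : ℂ) := by
  have : Nonempty (Fin n) := ⟨⟨0, hn⟩⟩
  obtain ⟨w, hw, hφ⟩ := exists_weights_of_positive_functional φ hpos A hA
  have hw1 : ∑ i, w i = 1 := by
    have := hφ 0 0
    simp only [pow_zero, hunital, mul_one] at this
    exact_mod_cast this.symm
  obtain ⟨m, hm⟩ : ∃ m : ℝ, φ A = m := ⟨∑ i, w i * hA.eigenvalues i, by simpa using hφ 0 1⟩
  rw [hm] at hB
  have hcenter : ∑ i, w i * (hA.eigenvalues i - m) = 0 := by
    have := hφ m 1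
    simp only [pow_one, map_sub, map_smul, hunital, hm, smul_eq_mul, mul_one, sub_self] at this
    exact_mod_cast this.symm
  have hs (i j : Fin n) : |hA.eigenvalues i - hA.eigenvalues j| ≤ spd := by
    rw [hspd]
    exact (le_ciSup (f := fun j => |hA.eigenvalues i - hA.eigenvalues j|)
      (Set.finite_range _).bddAbove j).trans
        (le_ciSup (f := fun i => ⨆ j, |hA.eigenvalues i - hA.eigenvalues j|)
          (Set.finite_range _).bddAbove i)
  obtain ⟨c, hc⟩ := exists_center_of_pairwise_dist_le hA.eigenvalues spd hs
  have key := central_moment_det_le w hA.eigenvalues hw hw1 m c (spd / 2) hcenter hc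
  rw [hB, hφ, hφ, hφ]
  have hbound : 4 * (spd / 2) ^ 6 / 27 = spd ^ 6 / 432 := by ring
  rw [hbound] at key
  exact_mod_cast key
end

section
/- Let φ be a positive unital linear functional on the n×n complex matrices and let A be a Hermitian n×n complex matrix with 0 ≤ A ≤ M·I in the positive semidefinite order (and A ≠ M·I in the sense that φ(A) < M). Then 0 ≤ φ(A)φ(A³) − φ(A²)² ≤ M⁴/27. -/
open ComplexOrder

/-- A functional that is nonnegative on positive semidefinite matrices is nonnegative on
`(A - t) P (A - t)` for `A` Hermitian, `t` real and `P` positive semidefinite commuting with `A`. -/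
theorem quadratic_nonneg_of_posSemidef {n : ℕ}
    (φ : Matrix (Fin n) (Fin n) ℂ →ₗ[ℂ] ℂ)
    (hpos : ∀ P : Matrix (Fin n) (Fin n) ℂ, P.PosSemidef → 0 ≤ φ P)
    {A P : Matrix (Fin n) (Fin n) ℂ} (hA : A.IsHermitian) (hP : P.PosSemidef)
    (hPA : Commute P A) (t : ℝ) :
    0 ≤ (φ P).re * (t * t) + (-2 * (φ (P * A)).re) * t + (φ (P * A ^ 2)).re := by
  have hB : (A - (t : ℂ) • 1).conjTranspose = A - (t : ℂ) • 1 := by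
    simp [Matrix.conjTranspose_sub, Matrix.conjTranspose_smul, hA.eq]
  have h := hpos _ (hP.mul_mul_conjTranspose_same (A - (t : ℂ) • 1))
  have hexp : (A - (t : ℂ) • 1) * P * (A - (t : ℂ) • 1) =
      ((t * t : ℝ) : ℂ) • P - ((2 * t : ℝ) : ℂ) • (P * A) + P * A ^ 2 := by
    have h1 : A * P = P * A := hPA.eq.symm
    simp only [sub_mul, mul_sub, smul_mul_assoc, mul_smul_comm, one_mul, mul_one, h1, smul_sub,
      smul_smul, pow_two, mul_assoc]
    push_cast
    module
  rw [hB, hexp, map_add, map_sub, map_smul, map_smul] at h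
  have h' := (Complex.le_def.1 h).1
  simp only [smul_eq_mul, Complex.add_re, Complex.sub_re, Complex.re_ofReal_mul,
    Complex.zero_re] at h'
  linarith

/-- The moment bound: the two Hankel determinant conditions on `[0, M]` force
`a c - b ^ 2 ≤ M ^ 4 / 27`. -/
theorem hankel_det_le_of_moment_ineq {a b c M : ℝ} (ha : 0 ≤ a) (haM : a < M)
    (h : (M * a - b) ^ 2 ≤ (M - a) * (M * b - c)) :
    a * c - b ^ 2 ≤ M ^ 4 / 27 := by
  have hM : 0 < M := ha.trans_lt haM
  have hd : 0 < M - a := sub_pos.2 haM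
  have h1 : (M - a) * (a * c - b ^ 2) ≤ (M - a) * (M * a ^ 2 * (M - a) / 4) := by
    nlinarith [mul_le_mul_of_nonneg_left h ha,
      mul_nonneg hM.le (sq_nonneg (b - a * (M + a) / 2))]
  have h2 : a ^ 2 * (M - a) / 4 ≤ M ^ 3 / 27 := by
    nlinarith [mul_nonneg (by positivity : 0 ≤ 3 * a + M) (sq_nonneg (3 * a - 2 * M))]
  have h3 := le_of_mul_le_mul_left h1 hd
  nlinarith [mul_le_mul_of_nonneg_left h2 hM.le]

theorem positive_functional_hankel_det_bounds {n : ℕ} (hn : 0 < n)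
    (φ : Matrix (Fin n) (Fin n) ℂ →ₗ[ℂ] ℂ)
    (hpos : ∀ P : Matrix (Fin n) (Fin n) ℂ, P.PosSemidef → 0 ≤ φ P)
    (hunital : φ 1 = 1)
    (A : Matrix (Fin n) (Fin n) ℂ) (M : ℝ)
    (hA0 : A.PosSemidef) (hAM : ((M : ℂ) • 1 - A).PosSemidef)
    (hφA : φ A < (M : ℂ)) :
    0 ≤ φ A * φ (A ^ 3) - φ (A ^ 2) ^ 2 ∧
      φ A * φ (A ^ 3) - φ (A ^ 2) ^ 2 ≤ ((M ^ 4 / 27 : ℝ) : ℂ) := by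
  have hreal (k : ℕ) : ((φ (A ^ k)).re : ℂ) = φ (A ^ k) :=
    (Complex.eq_re_of_ofReal_le (r := 0) (by simpa using hpos _ (hA0.pow k))).symm
  have ha : 0 ≤ (φ A).re := (Complex.le_def.1 (hpos A hA0)).1
  have haM : (φ A).re < M := (Complex.lt_def.1 hφA).1
  have hlow := discrim_le_zero
    (quadratic_nonneg_of_posSemidef φ hpos hA0.isHermitian hA0 (Commute.refl A))
  have hcomm : Commute ((M : ℂ) • 1 - A) A :=
    ((Commute.one_left A).smul_left _).sub_left (Commute.refl A)
  have hupp := discrim_le_zero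
    (quadratic_nonneg_of_posSemidef φ hpos hA0.isHermitian hAM hcomm)
  have e1 : A * A = A ^ 2 := (pow_two A).symm
  have e2 : A * A ^ 2 = A ^ 3 := (pow_succ' A 2).symm
  simp only [discrim, sub_mul, smul_mul_assoc, one_mul, e1, e2, map_sub, map_smul, hunital,
    smul_eq_mul, Complex.sub_re, Complex.re_ofReal_mul, mul_one,
    Complex.ofReal_re] at hlow hupp
  have hA1 := hreal 1
  rw [pow_one] at hA1
  rw [← hA1, ← hreal 2, ← hreal 3]
  norm_cast
  refine ⟨by linarith, hankel_det_le_of_moment_ineq ha haM (by linarith)⟩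
end

section
/- Let n ≥ 5 and let f(x) = xⁿ + a₂x^{n−2} + a₃x^{n−3} + a₄x^{n−4} + … + a_n be a monic real polynomial of degree n with zero coefficient of x^{n−1}, all of whose n roots x_1,…,x_n are real. Then the span of f satisfies (24/n·(a₂² − 2a₄))^{1/4} ≤ spn(f) and spn(f) ≤ 2(a₂² − 2a₄)^{1/4}; equivalently, (24/n)(a₂² − 2a₄) ≤ spn(f)⁴ ≤ 16(a₂² − 2a₄). -/
open Polynomial

/-- Vieta's formula for a product of linear factors, with the elementary symmetric functions
evaluated at the family of roots. -/
lemma coeff_prod_X_sub_C_eq_esymm {n : ℕ} (x : Fin n → ℝ) {k : ℕ} (hk : k ≤ n) :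
    (∏ i, (X - C (x i))).coeff (n - k) =
      (-1) ^ k * MvPolynomial.aeval x (MvPolynomial.esymm (Fin n) ℝ k) := by
  rw [MvPolynomial.aeval_esymm_eq_multiset_esymm]
  have h := Multiset.prod_X_sub_C_coeff (Finset.univ.val.map x) (k := n - k) (by simp)
  simp only [Multiset.map_map, Multiset.card_map, Finset.card_val, Finset.card_univ,
    Fintype.card_fin, Nat.sub_sub_self hk] at h
  exact h

/-- Newton's identity for the fourth power sum of a family with zero sum, in terms of the coefficients of the
polynomial having the family as its roots. -/
lemma sum_eq_zero_and_sum_pow_four_eq_coeff {n : ℕ} (hn : 4 ≤ n) (x : Fin n → ℝ)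
    (h1 : (∏ i, (X - C (x i))).coeff (n - 1) = 0) :
    ∑ i, x i = 0 ∧ ∑ i, x i ^ 4 =
      2 * ((∏ i, (X - C (x i))).coeff (n - 2) ^ 2 -
        2 * (∏ i, (X - C (x i))).coeff (n - 4)) := by
  have newton (k : ℕ) (hk : 0 < k) := congrArg (MvPolynomial.aeval x)
    (MvPolynomial.psum_eq_mul_esymm_sub_sum (Fin n) ℝ k hk)
  have n1 := newton 1 (by norm_num)
  have n2 := newton 2 (by norm_num)
  have n4 := newton 4 (by norm_num)
  rw [coeff_prod_X_sub_C_eq_esymm x (by omega)] at h1 ⊢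
  rw [coeff_prod_X_sub_C_eq_esymm x (by omega)]
  have p (k : ℕ) : MvPolynomial.eval x (MvPolynomial.psum (Fin n) ℝ k) = ∑ i, x i ^ k := by
    simp [MvPolynomial.psum]
  simp [-MvPolynomial.esymm_one, Finset.sum_filter, Finset.Nat.antidiagonal_succ, p]
    at n1 n2 n4 h1 ⊢
  rw [h1] at n1 n2 n4
  refine ⟨n1, ?_⟩
  rw [n4, n2, n1]
  ring

/-- The chord of `t ↦ t ^ 4` over `[m, M]` lies above the graph. -/
lemma pow_four_le_chord_s18 {m M t : ℝ} (hm : m ≤ t) (hM : t ≤ M) :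
    t ^ 4 ≤ (M + m) * (M ^ 2 + m ^ 2) * t - m * M * (m ^ 2 + m * M + M ^ 2) := by
  have hq : 0 ≤ t ^ 2 + (M + m) * t + (m ^ 2 + m * M + M ^ 2) := by
    nlinarith [sq_nonneg (t + M), sq_nonneg (t + m), sq_nonneg (m + M), sq_nonneg (t + m + M)]
  nlinarith [mul_nonneg (mul_nonneg (sub_nonneg.2 hm) (sub_nonneg.2 hM)) hq]

/-- **Theorem 4.1** (inequality (4.6)): let `n ≥ 5` and let
`f = xⁿ + a₂x^{n−2} + a₃x^{n−3} + … + aₙ` be a monic real polynomial (with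
zero coefficient of `x^{n−1}`) all of whose roots `x 1, …, x n` are real.
Then `(24/n)(a₂² − 2a₄) ≤ spn(f)⁴ ≤ 16(a₂² − 2a₄)`, where
`spn(f) = max_i x i − min_i x i` and `aₖ = f.coeff (n − k)`. -/
theorem span_fourth_power_bounds {n : ℕ} (hn : 5 ≤ n)
    (f : Polynomial ℝ) (x : Fin n → ℝ)
    (hf : f = ∏ i, (X - C (x i)))
    (ha1 : f.coeff (n - 1) = 0) :
    24 / (n : ℝ) * ((f.coeff (n - 2)) ^ 2 - 2 * f.coeff (n - 4)) ≤
        ((⨆ i, x i) - ⨅ i, x i) ^ 4 ∧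
      ((⨆ i, x i) - ⨅ i, x i) ^ 4 ≤
        16 * ((f.coeff (n - 2)) ^ 2 - 2 * f.coeff (n - 4)) := by
  subst hf
  obtain ⟨h0, h4⟩ := sum_eq_zero_and_sum_pow_four_eq_coeff (by omega) x ha1
  generalize (∏ i, (X - C (x i))).coeff (n - 2) ^ 2 -
    2 * (∏ i, (X - C (x i))).coeff (n - 4) = D at h4 ⊢
  have : Nonempty (Fin n) := ⟨⟨0, by omega⟩⟩
  have hle i : x i ≤ ⨆ i, x i := le_ciSup (Set.finite_range x).bddAbove i
  have hge i : ⨅ i, x i ≤ x i := ciInf_le (Set.finite_range x).bddBelow i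
  obtain ⟨i, hi⟩ := exists_eq_ciSup_of_finite (f := x)
  obtain ⟨j, hj⟩ := exists_eq_ciInf_of_finite (f := x)
  generalize (⨆ i, x i) = M at *
  generalize (⨅ i, x i) = m at *
  have hnpos : (0 : ℝ) < n := by exact_mod_cast (by omega : 0 < n)
  constructor
  · have hsum := Finset.sum_le_sum fun i (_ : i ∈ Finset.univ) => pow_four_le_chord_s18 (hge i) (hle i)
    rw [Finset.sum_sub_distrib, ← Finset.mul_sum, h0, h4] at hsum
    simp only [Finset.sum_const, Finset.card_univ, Fintype.card_fin, nsmul_eq_mul] at hsum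
    have key : -(12 * (m * M * (m ^ 2 + m * M + M ^ 2))) ≤ (M - m) ^ 4 := by
      nlinarith [sq_nonneg ((M - m) ^ 2 + 6 * (m * M))]
    rw [div_mul_eq_mul_div, div_le_iff₀ hnpos]
    nlinarith [mul_le_mul_of_nonneg_left key hnpos.le]
  · rcases eq_or_ne i j with rfl | hij
    · have hD : 0 ≤ ∑ i, x i ^ 4 := Finset.sum_nonneg fun i _ => by positivity
      rw [← hi, ← hj]
      linarith
    · have hpair : x i ^ 4 + x j ^ 4 ≤ ∑ k, x k ^ 4 := by
        rw [← Finset.sum_pair hij (f := fun k => x k ^ 4)]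
        exact Finset.sum_le_sum_of_subset_of_nonneg (Finset.subset_univ _)
          fun k _ _ => by positivity
      rw [hi, hj] at hpair
      have h8 : (M - m) ^ 4 ≤ 8 * (M ^ 4 + m ^ 4) := by
        nlinarith [sq_nonneg (M + m), sq_nonneg (M ^ 2 - m ^ 2),
          sq_nonneg ((M + m) ^ 2), mul_nonneg (sq_nonneg (M + m)) (sq_nonneg (M - m))]
      linarith
end

section
/- Let n ≥ 5 and let f(x) = xⁿ + a₂x^{n−2} + a₃x^{n−3} + a₄x^{n−4} + … + a_n be a monic real polynomial of degree n with zero coefficient of x^{n−1}, all of whose n roots x_1,…,x_n are real. Then the span of f satisfies spn(f)⁶ ≥ (432/n³)·(4(2−n)a₂³ − 9n·a₃² + 8n·a₂a₄). -/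
open Polynomial

/-- Hadamard's inequality for the determinant of a `3 × 3` Gram matrix, written out. -/
lemma gram_det_three_le {ι : Type*} (s : Finset ι) (u v w : ι → ℝ) :
    (∑ i ∈ s, u i ^ 2) * (∑ i ∈ s, v i ^ 2) * (∑ i ∈ s, w i ^ 2)
      + 2 * (∑ i ∈ s, u i * v i) * (∑ i ∈ s, u i * w i) * (∑ i ∈ s, v i * w i)
      - (∑ i ∈ s, u i ^ 2) * (∑ i ∈ s, v i * w i) ^ 2
      - (∑ i ∈ s, v i ^ 2) * (∑ i ∈ s, u i * w i) ^ 2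
      - (∑ i ∈ s, w i ^ 2) * (∑ i ∈ s, u i * v i) ^ 2
      ≤ (∑ i ∈ s, u i ^ 2) * (∑ i ∈ s, v i ^ 2) * (∑ i ∈ s, w i ^ 2) := by
  have huv := Finset.sum_mul_sq_le_sq_mul_sq s u v
  have huw := Finset.sum_mul_sq_le_sq_mul_sq s u w
  have hA : 0 ≤ ∑ i ∈ s, u i ^ 2 := Finset.sum_nonneg fun i _ => sq_nonneg _
  generalize (∑ i ∈ s, u i ^ 2) = A at *
  generalize (∑ i ∈ s, v i ^ 2) = B at *
  generalize (∑ i ∈ s, w i ^ 2) = C at *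
  generalize (∑ i ∈ s, u i * v i) = D at *
  generalize (∑ i ∈ s, u i * w i) = E at *
  generalize (∑ i ∈ s, v i * w i) = F at *
  rcases hA.eq_or_lt with rfl | hA
  · have hD : D = 0 := by nlinarith
    have hE : E = 0 := by nlinarith
    simp [hD, hE]
  · refine le_of_mul_le_mul_left ?_ hA
    have h : (A * B - D ^ 2) * (A * C - E ^ 2) ≤ (A * B) * (A * C) :=
      mul_le_mul (by nlinarith) (by nlinarith) (by linarith) (by nlinarith)
    nlinarith [sq_nonneg (A * F - D * E)]

lemma mul_mul_le_of_sum_le {a b c t : ℝ} (ha : 0 ≤ a) (hb : 0 ≤ b) (hc : 0 ≤ c)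
    (h : a + b + c ≤ t) : 27 * (a * b * c) ≤ t ^ 3 := by
  have h₁ : 27 * (a * b * c) ≤ (a + b + c) ^ 3 := by
    nlinarith [mul_nonneg ha (sq_nonneg (b - c)), mul_nonneg hb (sq_nonneg (a - c)),
      mul_nonneg hc (sq_nonneg (a - b)), mul_nonneg ha (sq_nonneg (a - b)),
      mul_nonneg ha (sq_nonneg (a - c)), mul_nonneg hb (sq_nonneg (b - c)),
      mul_nonneg hb (sq_nonneg (a - b)), mul_nonneg hc (sq_nonneg (c - b)),
      mul_nonneg hc (sq_nonneg (a - c))]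
  exact h₁.trans (pow_le_pow_left₀ (by positivity) h 3)

/-- The Hankel determinant of the moments of finitely many points in `[-h, h]` is maximal for
the uniform distribution on `{-h, 0, h}`. -/
lemma hankel_det_le {ι : Type*} (s : Finset ι) (y : ι → ℝ) {h : ℝ} (hh : 0 < h)
    (hy : ∀ i ∈ s, y i ^ 2 ≤ h ^ 2) :
    27 * ((s.card : ℝ) * (∑ i ∈ s, y i ^ 2) * (∑ i ∈ s, y i ^ 4)
      + 2 * (∑ i ∈ s, y i) * (∑ i ∈ s, y i ^ 2) * (∑ i ∈ s, y i ^ 3)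
      - (s.card : ℝ) * (∑ i ∈ s, y i ^ 3) ^ 2
      - (∑ i ∈ s, y i) ^ 2 * (∑ i ∈ s, y i ^ 4) - (∑ i ∈ s, y i ^ 2) ^ 3)
      ≤ 4 * (s.card : ℝ) ^ 3 * h ^ 6 := by
  have hG := gram_det_three_le s (fun i => y i * (y i + h) / 2) (fun i => y i * (y i - h) / 2)
    (fun i => h ^ 2 - y i ^ 2)
  have hle : ∑ i ∈ s, (y i * (y i + h) / 2) ^ 2 + ∑ i ∈ s, (y i * (y i - h) / 2) ^ 2
      + ∑ i ∈ s, (h ^ 2 - y i ^ 2) ^ 2 ≤ s.card * h ^ 4 := by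
    rw [← Finset.sum_add_distrib, ← Finset.sum_add_distrib, ← nsmul_eq_mul]
    refine Finset.sum_le_card_nsmul _ _ _ fun i hi => ?_
    nlinarith [mul_nonneg (sq_nonneg (y i)) (sub_nonneg.2 (hy i hi))]
  have hprod := mul_mul_le_of_sum_le (Finset.sum_nonneg fun i _ => sq_nonneg _)
    (Finset.sum_nonneg fun i _ => sq_nonneg _) (Finset.sum_nonneg fun i _ => sq_nonneg _) hle
  have key := (mul_le_mul_of_nonneg_left hG (by norm_num : (0 : ℝ) ≤ 27)).trans hprod
  have sums (a b c d e : ℝ) : ∑ i ∈ s, (a + b * y i + c * y i ^ 2 + d * y i ^ 3 + e * y i ^ 4)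
      = s.card * a + b * (∑ i ∈ s, y i) + c * (∑ i ∈ s, y i ^ 2) + d * (∑ i ∈ s, y i ^ 3)
        + e * (∑ i ∈ s, y i ^ 4) := by
    simp only [Finset.sum_add_distrib, Finset.mul_sum, Finset.sum_const, nsmul_eq_mul]
  have e₁ : ∑ i ∈ s, (y i * (y i + h) / 2) ^ 2 = _ :=
    (Finset.sum_congr rfl fun i _ => by ring).trans (sums 0 0 (h ^ 2 / 4) (h / 2) (1 / 4))
  have e₂ : ∑ i ∈ s, (y i * (y i - h) / 2) ^ 2 = _ :=
    (Finset.sum_congr rfl fun i _ => by ring).trans (sums 0 0 (h ^ 2 / 4) (-h / 2) (1 / 4))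
  have e₃ : ∑ i ∈ s, (h ^ 2 - y i ^ 2) ^ 2 = _ :=
    (Finset.sum_congr rfl fun i _ => by ring).trans (sums (h ^ 4) 0 (-2 * h ^ 2) 0 1)
  have e₄ : ∑ i ∈ s, (y i * (y i + h) / 2) * (y i * (y i - h) / 2) = _ :=
    (Finset.sum_congr rfl fun i _ => by ring).trans (sums 0 0 (-h ^ 2 / 4) 0 (1 / 4))
  have e₅ : ∑ i ∈ s, (y i * (y i + h) / 2) * (h ^ 2 - y i ^ 2) = _ :=
    (Finset.sum_congr rfl fun i _ => by ring).trans
      (sums 0 (h ^ 3 / 2) (h ^ 2 / 2) (-h / 2) (-1 / 2))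
  have e₆ : ∑ i ∈ s, (y i * (y i - h) / 2) * (h ^ 2 - y i ^ 2) = _ :=
    (Finset.sum_congr rfl fun i _ => by ring).trans
      (sums 0 (-h ^ 3 / 2) (h ^ 2 / 2) (h / 2) (-1 / 2))
  rw [e₁, e₂, e₃, e₄, e₅, e₆] at key
  have hpos : 0 < h ^ 6 / 4 := by positivity
  refine le_of_mul_le_mul_left ?_ hpos
  refine le_of_eq_of_le ?_ (key.trans_eq ?_) <;> ring

/-- The Hankel determinant bound for points with zero sum lying in an interval `[a, b]`. -/
lemma centered_hankel_det_le {ι : Type*} (s : Finset ι) (x : ι → ℝ) {a b : ℝ} (hab : a ≤ b)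
    (hx : ∀ i ∈ s, a ≤ x i ∧ x i ≤ b) (h₁ : ∑ i ∈ s, x i = 0) :
    432 * ((s.card : ℝ) * (∑ i ∈ s, x i ^ 2) * (∑ i ∈ s, x i ^ 4)
      - (s.card : ℝ) * (∑ i ∈ s, x i ^ 3) ^ 2 - (∑ i ∈ s, x i ^ 2) ^ 3)
      ≤ (s.card : ℝ) ^ 3 * (b - a) ^ 6 := by
  rcases hab.eq_or_lt with rfl | hab
  · have hxa : ∀ i ∈ s, x i = a := fun i hi => le_antisymm (hx i hi).2 (hx i hi).1
    have sums (k : ℕ) : ∑ i ∈ s, x i ^ k = s.card * a ^ k := by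
      rw [Finset.sum_congr rfl fun i hi => by rw [hxa i hi], Finset.sum_const, nsmul_eq_mul]
    rw [Finset.sum_congr rfl hxa, Finset.sum_const, nsmul_eq_mul] at h₁
    rw [sums, sums, sums]
    rcases mul_eq_zero.1 h₁ with h | h <;> simp [h]
  · have key := hankel_det_le s (fun i => x i - (a + b) / 2) (h := (b - a) / 2) (by linarith)
      fun i hi => by nlinarith [mul_nonneg (sub_nonneg.2 (hx i hi).1) (sub_nonneg.2 (hx i hi).2)]
    generalize (a + b) / 2 = c at key
    have sums (p q r t e : ℝ) :
        ∑ i ∈ s, (p + q * x i + r * x i ^ 2 + t * x i ^ 3 + e * x i ^ 4)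
        = s.card * p + r * (∑ i ∈ s, x i ^ 2) + t * (∑ i ∈ s, x i ^ 3)
          + e * (∑ i ∈ s, x i ^ 4) := by
      simp only [Finset.sum_add_distrib, ← Finset.mul_sum, Finset.sum_const, nsmul_eq_mul, h₁,
        mul_zero, add_zero]
    have e₁ : ∑ i ∈ s, (x i - c) = _ :=
      (Finset.sum_congr rfl fun i _ => by ring).trans (sums (-c) 1 0 0 0)
    have e₂ : ∑ i ∈ s, (x i - c) ^ 2 = _ :=
      (Finset.sum_congr rfl fun i _ => by ring).trans (sums (c ^ 2) (-2 * c) 1 0 0)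
    have e₃ : ∑ i ∈ s, (x i - c) ^ 3 = _ :=
      (Finset.sum_congr rfl fun i _ => by ring).trans (sums (-c ^ 3) (3 * c ^ 2) (-3 * c) 1 0)
    have e₄ : ∑ i ∈ s, (x i - c) ^ 4 = _ :=
      (Finset.sum_congr rfl fun i _ => by ring).trans
        (sums (c ^ 4) (-4 * c ^ 3) (6 * c ^ 2) (-4 * c) 1)
    rw [e₁, e₂, e₃, e₄] at key
    refine le_of_eq_of_le ?_ ((mul_le_mul_of_nonneg_left key
      (by norm_num : (0 : ℝ) ≤ 16)).trans_eq ?_) <;> ring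

lemma coeff_prod_X_sub_C_eq_eval_esymm {n k : ℕ} (hk : k ≤ n) (x : Fin n → ℝ) :
    (∏ i, (X - C (x i))).coeff (n - k)
      = (-1) ^ k * MvPolynomial.eval x (MvPolynomial.esymm (Fin n) ℝ k) := by
  have h := Multiset.prod_X_sub_C_coeff (Finset.univ.val.map x) (k := n - k) (by simp)
  rw [Multiset.map_map, Multiset.card_map, Finset.card_val, Finset.card_univ, Fintype.card_fin,
    Nat.sub_sub_self hk] at h
  rw [← MvPolynomial.coe_aeval_eq_eval, RingHom.coe_coe,
    MvPolynomial.aeval_esymm_eq_multiset_esymm]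
  exact h

lemma eval_newton {n : ℕ} (x : Fin n → ℝ) (k : ℕ) :
    (k : ℝ) * MvPolynomial.eval x (MvPolynomial.esymm (Fin n) ℝ k)
      = (-1) ^ (k + 1) * ∑ j ∈ Finset.range k,
        (-1) ^ j * MvPolynomial.eval x (MvPolynomial.esymm (Fin n) ℝ j)
          * ∑ i, x i ^ (k - j) := by
  have h := congrArg (MvPolynomial.eval x) (MvPolynomial.mul_esymm_eq_sum (Fin n) ℝ k)
  rw [Finset.sum_filter, Finset.Nat.sum_antidiagonal_eq_sum_range_succ_mk, Finset.sum_range_succ,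
    if_neg (lt_irrefl k), add_zero,
    Finset.sum_congr rfl fun j hj => if_pos (Finset.mem_range.1 hj)] at h
  simpa [MvPolynomial.psum] using h

/-- **Theorem 4.2** (inequality (4.8)): let `n ≥ 5` and let
`f = xⁿ + a₂x^{n−2} + a₃x^{n−3} + … + aₙ` be a monic real polynomial (with
zero coefficient of `x^{n−1}`) all of whose roots `x 1, …, x n` are real.
Then `spn(f)⁶ ≥ (432/n³)(4(2−n)a₂³ − 9n·a₃² + 8n·a₂a₄)`, where
`spn(f) = max_i x i − min_i x i` and `aₖ = f.coeff (n − k)`. -/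
theorem span_sixth_power_lower_bound {n : ℕ} (hn : 5 ≤ n)
    (f : Polynomial ℝ) (x : Fin n → ℝ)
    (hf : f = ∏ i, (X - C (x i)))
    (ha1 : f.coeff (n - 1) = 0) :
    432 / (n : ℝ) ^ 3 *
        (4 * (2 - (n : ℝ)) * (f.coeff (n - 2)) ^ 3 -
          9 * (n : ℝ) * (f.coeff (n - 3)) ^ 2 +
          8 * (n : ℝ) * f.coeff (n - 2) * f.coeff (n - 4)) ≤
      ((⨆ i, x i) - ⨅ i, x i) ^ 6 := by
  subst hf
  rw [coeff_prod_X_sub_C_eq_eval_esymm (by omega)] at ha1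
  rw [coeff_prod_X_sub_C_eq_eval_esymm (by omega), coeff_prod_X_sub_C_eq_eval_esymm (by omega),
    coeff_prod_X_sub_C_eq_eval_esymm (by omega)]
  have n₁ := eval_newton x 1
  have n₂ := eval_newton x 2
  have n₃ := eval_newton x 3
  have n₄ := eval_newton x 4
  simp only [Finset.sum_range_succ, Finset.sum_range_zero, MvPolynomial.esymm_zero, map_one,
    pow_zero, zero_add, mul_one, one_mul, Nat.cast_one, Nat.sub_zero, pow_one, Nat.cast_ofNat,
    Nat.add_one_sub_one, Nat.reduceSub, Nat.reduceAdd] at n₁ n₂ n₃ n₄ ha1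
  have h₁ : ∑ i, x i = 0 := by linarith
  rw [ha1, h₁] at n₂ n₃ n₄
  have hbdd := Set.finite_range x
  have hn0 : (0 : ℝ) < n := by exact_mod_cast (by omega : 0 < n)
  have hx (i) : (⨅ i, x i) ≤ x i ∧ x i ≤ ⨆ i, x i :=
    ⟨ciInf_le hbdd.bddBelow i, le_ciSup hbdd.bddAbove i⟩
  let i₀ : Fin n := ⟨0, by omega⟩
  have key := centered_hankel_det_le Finset.univ x ((hx i₀).1.trans (hx i₀).2)
    (fun i _ => hx i) h₁
  rw [Finset.card_univ, Fintype.card_fin] at key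
  rw [div_mul_eq_mul_div, div_le_iff₀ (by positivity), mul_comm (_ ^ 6)]
  generalize MvPolynomial.eval x (MvPolynomial.esymm (Fin n) ℝ 2) = e₂ at *
  generalize MvPolynomial.eval x (MvPolynomial.esymm (Fin n) ℝ 3) = e₃ at *
  generalize MvPolynomial.eval x (MvPolynomial.esymm (Fin n) ℝ 4) = e₄ at *
  have p₂ : ∑ i, x i ^ 2 = -2 * e₂ := by linarith
  have p₃ : ∑ i, x i ^ 3 = 3 * e₃ := by linarith
  have p₄ : ∑ i, x i ^ 4 = 2 * e₂ ^ 2 - 4 * e₄ := by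
    rw [p₂] at n₄
    linarith
  rw [p₂, p₃, p₄] at key
  exact le_of_eq_of_le (by ring) key
end
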